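/- arXiv:1711.00948 — 2 statements merged into one kernel-verified Lean document; each statement's English description precedes it below -/
import Mathlib

section
/- For every K ≥ 1 there exists C > 0 depending only on K with the following property. Assume f : ℝ³ × ℝ × ℝ³ → ℝ is of class C² with f ≥ 1/K everywhere and with |f| and all partial derivatives of f up to order 2 bounded by K; u : ℝ³ → ℝ is C^∞ on B₁₀ with σ₂(D²u(x)) = f(x, u(x), Du(x)) and Δu(x) > 0 on B₁₀; and |u(x)| + |Du(x)| ≤ K on B₁₀. Set F(x) := f(x, u(x), Du(x)) and V := log(F·Δu − det D²u) (the argument is positive, since F·Δu − det D²u = det(Δu·I − D²u) and Δu·I − D²u is positive definite). Then at every x ∈ B₄: Σ_{i,j} σ₂^{ij}(x) ∂_i∂_j V(x) ≥ −C·Δu(x) + Σ_i f_{u_i}(x) ∂_i V(x). -/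
open Metric MeasureTheory Real

noncomputable section

abbrev E3 : Type := EuclideanSpace ℝ (Fin 3)

/-- The `i`-th partial derivative of `u`. -/
def pd (i : Fin 3) (u : E3 → ℝ) : E3 → ℝ :=
  fun x => fderiv ℝ u x (EuclideanSpace.single i 1)

/-- The gradient `Du` of `u` as a vector in `ℝ³`. -/
def grad (u : E3 → ℝ) (x : E3) : E3 :=
  (WithLp.equiv 2 (Fin 3 → ℝ)).symm (fun i => pd i u x)

/-- The Hessian matrix `D²u`. -/
def hess (u : E3 → ℝ) (x : E3) : Matrix (Fin 3) (Fin 3) ℝ :=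
  Matrix.of fun i j => pd i (pd j u) x

/-- The Laplacian `Δu`. -/
def lap (u : E3 → ℝ) (x : E3) : ℝ := ∑ i, hess u x i i

def sigma1 (A : Matrix (Fin 3) (Fin 3) ℝ) : ℝ := A.trace

def sigma2 (A : Matrix (Fin 3) (Fin 3) ℝ) : ℝ := (A.trace ^ 2 - (A * A).trace) / 2

def sigma3 (A : Matrix (Fin 3) (Fin 3) ℝ) : ℝ := A.det

/-- The matrix `σ₂^{ij}(x) = Δu(x) δ_{ij} - ∂_i∂_j u(x)`. -/
def sg (u : E3 → ℝ) (x : E3) : Matrix (Fin 3) (Fin 3) ℝ :=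
  lap u x • (1 : Matrix (Fin 3) (Fin 3) ℝ) - hess u x

/-- `f_{u_p}`: the partial derivative of `f` in its `p`-th gradient variable,
evaluated at `(x, u(x), Du(x))`. -/
def fp (f : E3 × ℝ × E3 → ℝ) (u : E3 → ℝ) (p : Fin 3) (x : E3) : ℝ :=
  fderiv ℝ f (x, u x, grad u x) (0, 0, EuclideanSpace.single p 1)

/-- The standing hypotheses: `f` is `C²`, bounded below by `1/K`, with `|f|` and all
derivatives up to order 2 bounded by `K`; `u` is smooth on `B₁₀`, solves
`σ₂(D²u) = f(x,u,Du)` with `Δu > 0` on `B₁₀`, and `|u| + |Du| ≤ K` on `B₁₀`. -/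
def Hyp (K : ℝ) (f : E3 × ℝ × E3 → ℝ) (u : E3 → ℝ) : Prop :=
  ContDiff ℝ 2 f ∧
  (∀ z, 1 / K ≤ f z) ∧
  (∀ z, ∀ k : ℕ, k ≤ 2 → ‖iteratedFDeriv ℝ k f z‖ ≤ K) ∧
  ContDiffOn ℝ (⊤ : ℕ∞) u (ball (0 : E3) 10) ∧
  (∀ x ∈ ball (0 : E3) 10, sigma2 (hess u x) = f (x, u x, grad u x)) ∧
  (∀ x ∈ ball (0 : E3) 10, 0 < lap u x) ∧
  (∀ x ∈ ball (0 : E3) 10, |u x| + ‖grad u x‖ ≤ K)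


lemma pd_congr {i : Fin 3} {g h : E3 → ℝ} {x : E3} (e : g =ᶠ[nhds x] h) :
    pd i g =ᶠ[nhds x] pd i h := by
  filter_upwards [e.fderiv (𝕜 := ℝ)] with y hy
  simp [pd, hy]

lemma pd_contDiffAt {i : Fin 3} {g : E3 → ℝ} {x : E3} (n m : WithTop ℕ∞) (hmn : m + 1 ≤ n)
    (h : ContDiffAt ℝ n g x) : ContDiffAt ℝ m (pd i g) x := by
  unfold pd
  exact (h.fderiv_right hmn).clm_apply contDiffAt_const

lemma pd_add {i : Fin 3} {g h : E3 → ℝ} {x : E3} (hg : DifferentiableAt ℝ g x)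
    (hh : DifferentiableAt ℝ h x) : pd i (fun y => g y + h y) x = pd i g x + pd i h x := by
  unfold pd
  rw [fderiv_fun_add hg hh]; rfl

lemma pd_sub {i : Fin 3} {g h : E3 → ℝ} {x : E3} (hg : DifferentiableAt ℝ g x)
    (hh : DifferentiableAt ℝ h x) : pd i (fun y => g y - h y) x = pd i g x - pd i h x := by
  unfold pd
  rw [fderiv_fun_sub hg hh]; rfl

lemma pd_mul {i : Fin 3} {g h : E3 → ℝ} {x : E3} (hg : DifferentiableAt ℝ g x)
    (hh : DifferentiableAt ℝ h x) :
    pd i (fun y => g y * h y) x = pd i g x * h x + g x * pd i h x := by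
  unfold pd
  rw [fderiv_fun_mul hg hh]
  simp; ring

lemma pd_log {i : Fin 3} {g : E3 → ℝ} {x : E3} (hg : DifferentiableAt ℝ g x) (h0 : g x ≠ 0) :
    pd i (fun y => Real.log (g y)) x = pd i g x * (g x)⁻¹ := by
  unfold pd
  rw [fderiv.log hg h0]
  simp; ring

lemma pd_inv {i : Fin 3} {g : E3 → ℝ} {x : E3} (hg : DifferentiableAt ℝ g x) (h0 : g x ≠ 0) :
    pd i (fun y => (g y)⁻¹) x = - pd i g x * (g x)⁻¹ ^ 2 := by
  unfold pd
  have := ((hasDerivAt_inv h0).comp_hasFDerivAt x hg.hasFDerivAt).fderiv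
  rw [show (fun y => (g y)⁻¹) = (fun t : ℝ => t⁻¹) ∘ g from rfl, this]
  simp; ring

lemma pd_comm {i j : Fin 3} {g : E3 → ℝ} {x : E3} (hg : ContDiffAt ℝ 2 g x) :
    pd i (pd j g) x = pd j (pd i g) x := by
  have hs : IsSymmSndFDerivAt ℝ g x := hg.isSymmSndFDerivAt (by simp)
  have hd : DifferentiableAt ℝ (fderiv ℝ g) x :=
    (hg.fderiv_right (m := 1) (by norm_num)).differentiableAt (by simp)
  have key : ∀ i j : Fin 3, pd i (pd j g) x =
      fderiv ℝ (fderiv ℝ g) x (EuclideanSpace.single i 1) (EuclideanSpace.single j 1) := by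
    intro i j
    unfold pd
    rw [fderiv_clm_apply hd (differentiableAt_const _)]
    simp
  rw [key, key]
  exact hs _ _

/-- second order jets in direction `i` -/
structure Jet (i : Fin 3) (x : E3) (g : E3 → ℝ) (a b c : ℝ) : Prop where
  cd : ContDiffAt ℝ 2 g x
  v : g x = a
  d : pd i g x = b
  dd : pd i (pd i g) x = c

lemma ContDiffAt.evDiff {g : E3 → ℝ} {x : E3} (h : ContDiffAt ℝ 2 g x) :
    ∀ᶠ y in nhds x, DifferentiableAt ℝ g y := by
  filter_upwards [h.eventually (by simp)] with y hy
  exact hy.differentiableAt (by simp)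

lemma ContDiffAt.pdDiff {i : Fin 3} {g : E3 → ℝ} {x : E3} (h : ContDiffAt ℝ 2 g x) :
    DifferentiableAt ℝ (pd i g) x :=
  (pd_contDiffAt 2 1 (by norm_num) h).differentiableAt (by simp)

lemma Jet.add {i x g h a b c a' b' c'} (H : Jet i x g a b c) (H' : Jet i x h a' b' c') :
    Jet i x (fun y => g y + h y) (a + a') (b + b') (c + c') := by
  have hg := H.cd.differentiableAt (by simp)
  have hh := H'.cd.differentiableAt (by simp)
  refine ⟨H.cd.add H'.cd, by simp [H.v, H'.v], by rw [pd_add hg hh, H.d, H'.d], ?_⟩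
  have e : pd i (fun y => g y + h y) =ᶠ[nhds x] fun y => pd i g y + pd i h y := by
    filter_upwards [H.cd.evDiff, H'.cd.evDiff] with y h1 h2 using pd_add h1 h2
  rw [(pd_congr e).self_of_nhds, pd_add H.cd.pdDiff H'.cd.pdDiff, H.dd, H'.dd]

lemma Jet.sub {i x g h a b c a' b' c'} (H : Jet i x g a b c) (H' : Jet i x h a' b' c') :
    Jet i x (fun y => g y - h y) (a - a') (b - b') (c - c') := by
  have hg := H.cd.differentiableAt (by simp)
  have hh := H'.cd.differentiableAt (by simp)
  refine ⟨H.cd.sub H'.cd, by simp [H.v, H'.v], by rw [pd_sub hg hh, H.d, H'.d], ?_⟩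
  have e : pd i (fun y => g y - h y) =ᶠ[nhds x] fun y => pd i g y - pd i h y := by
    filter_upwards [H.cd.evDiff, H'.cd.evDiff] with y h1 h2 using pd_sub h1 h2
  rw [(pd_congr e).self_of_nhds, pd_sub H.cd.pdDiff H'.cd.pdDiff, H.dd, H'.dd]

lemma Jet.mul {i x g h a b c a' b' c'} (H : Jet i x g a b c) (H' : Jet i x h a' b' c') :
    Jet i x (fun y => g y * h y) (a * a') (b * a' + a * b') (c * a' + 2 * b * b' + a * c') := by
  have hg := H.cd.differentiableAt (by simp)
  have hh := H'.cd.differentiableAt (by simp)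
  refine ⟨H.cd.mul H'.cd, by simp [H.v, H'.v], by rw [pd_mul hg hh, H.d, H'.d, H.v, H'.v], ?_⟩
  have e : pd i (fun y => g y * h y) =ᶠ[nhds x] fun y => pd i g y * h y + g y * pd i h y := by
    filter_upwards [H.cd.evDiff, H'.cd.evDiff] with y h1 h2 using pd_mul h1 h2
  rw [(pd_congr e).self_of_nhds, pd_add (H.cd.pdDiff.fun_mul hh) (hg.fun_mul H'.cd.pdDiff),
    pd_mul H.cd.pdDiff hh, pd_mul hg H'.cd.pdDiff, H.dd, H'.dd, H.d, H'.d, H.v, H'.v]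
  ring

lemma Jet.log {i x g a b c} (H : Jet i x g a b c) (h0 : a ≠ 0) :
    Jet i x (fun y => Real.log (g y)) (Real.log a) (b * a⁻¹) (c * a⁻¹ - (b * a⁻¹) ^ 2) := by
  have hg := H.cd.differentiableAt (by simp)
  have h0' : g x ≠ 0 := by rw [H.v]; exact h0
  refine ⟨H.cd.log h0', by simp [H.v], by rw [pd_log hg h0', H.d, H.v], ?_⟩
  have e : pd i (fun y => Real.log (g y)) =ᶠ[nhds x] fun y => pd i g y * (g y)⁻¹ := by
    filter_upwards [H.cd.evDiff, H.cd.continuousAt.eventually_ne h0'] with y h1 h2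
      using pd_log h1 h2
  rw [(pd_congr e).self_of_nhds, pd_mul H.cd.pdDiff (hg.fun_inv h0'), pd_inv hg h0', H.dd, H.d, H.v]
  ring

lemma Jet.congr {i x g h a b c a' b' c'} (H : Jet i x g a b c) (e : h =ᶠ[nhds x] g)
    (ha : a = a') (hb : b = b') (hc : c = c') :
    Jet i x h a' b' c' := by
  subst ha hb hc
  refine ⟨H.cd.congr_of_eventuallyEq e, ?_, ?_, ?_⟩
  · rw [e.self_of_nhds, H.v]
  · rw [(pd_congr e).self_of_nhds, H.d]
  · rw [(pd_congr (pd_congr e)).self_of_nhds, H.dd]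

lemma Jet.of {i x} {g : E3 → ℝ} (H : ContDiffAt ℝ 2 g x) :
    Jet i x g (g x) (pd i g x) (pd i (pd i g) x) := ⟨H, rfl, rfl, rfl⟩

/-- jet of `σ₂` at a diagonal point -/
lemma Jet.sig {i x g1 g2 g3 o1 o2 o3 a1 a2 a3 b1 b2 b3 c1 c2 c3 d1 d2 d3 e1 e2 e3}
    (H1 : Jet i x g1 a1 b1 c1) (H2 : Jet i x g2 a2 b2 c2) (H3 : Jet i x g3 a3 b3 c3)
    (O1 : Jet i x o1 0 d1 e1) (O2 : Jet i x o2 0 d2 e2) (O3 : Jet i x o3 0 d3 e3) :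
    Jet i x (fun y => g1 y * g2 y + g1 y * g3 y + g2 y * g3 y - o1 y * o1 y - o2 y * o2 y
      - o3 y * o3 y) (a1 * a2 + a1 * a3 + a2 * a3)
      ((a2 + a3) * b1 + (a1 + a3) * b2 + (a1 + a2) * b3)
      ((a2 + a3) * c1 + (a1 + a3) * c2 + (a1 + a2) * c3 + 2 * (b1 * b2 + b1 * b3 + b2 * b3
        - d1 ^ 2 - d2 ^ 2 - d3 ^ 2)) := by
  refine ((((((H1.mul H2).add (H1.mul H3)).add (H2.mul H3)).sub (O1.mul O1)).sub
    (O2.mul O2)).sub (O3.mul O3)).congr (Filter.EventuallyEq.refl _ _) ?_ ?_ ?_ <;> ring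

/-- jet of `log det W` at a diagonal point -/
lemma Jet.logdet {i x g1 g2 g3 o1 o2 o3 a1 a2 a3 b1 b2 b3 c1 c2 c3 d1 d2 d3 e1 e2 e3}
    (H1 : Jet i x g1 a1 b1 c1) (H2 : Jet i x g2 a2 b2 c2) (H3 : Jet i x g3 a3 b3 c3)
    (O1 : Jet i x o1 0 d1 e1) (O2 : Jet i x o2 0 d2 e2) (O3 : Jet i x o3 0 d3 e3)
    (h1 : a1 ≠ 0) (h2 : a2 ≠ 0) (h3 : a3 ≠ 0) :
    Jet i x (fun y => Real.log (g1 y * g2 y * g3 y - (o1 y * o2 y * o3 y + o1 y * o2 y * o3 y)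
      - g1 y * (o1 y * o1 y) - g2 y * (o2 y * o2 y) - g3 y * (o3 y * o3 y)))
      (Real.log (a1 * a2 * a3))
      (b1 / a1 + b2 / a2 + b3 / a3)
      (c1 / a1 + c2 / a2 + c3 / a3 - b1 ^ 2 / a1 ^ 2 - b2 ^ 2 / a2 ^ 2 - b3 ^ 2 / a3 ^ 2
        - 2 * d1 ^ 2 / (a2 * a3) - 2 * d2 ^ 2 / (a1 * a3) - 2 * d3 ^ 2 / (a1 * a2)) := by
  have h0 : a1 * a2 * a3 ≠ 0 := by positivity
  have ooo := (O1.mul O2).mul O3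
  refine (Jet.log ((((((H1.mul H2).mul H3).sub (ooo.add ooo)).sub (H1.mul (O1.mul O1))).sub
    (H2.mul (O2.mul O2))).sub (H3.mul (O3.mul O3))) (by simpa using h0)).congr
      (Filter.EventuallyEq.refl _ _) ?_ ?_ ?_
  · simp
  · simp; field_simp
  · simp; field_simp; ring

lemma le_infty3 : (3 : WithTop ℕ∞) ≤ ((⊤ : ℕ∞) : WithTop ℕ∞) := by
  change ((3 : ℕ∞) : WithTop ℕ∞) ≤ _
  exact WithTop.coe_le_coe.2 le_top

/-- vector with given coordinates -/
def vec (a : Fin 3 → ℝ) : E3 := (WithLp.equiv 2 (Fin 3 → ℝ)).symm a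

lemma fderiv_vec {a : Fin 3 → E3 → ℝ} {y : E3} (h : ∀ p, DifferentiableAt ℝ (a p) y) (k : Fin 3) :
    DifferentiableAt ℝ (fun z => vec (fun p => a p z)) y ∧
    fderiv ℝ (fun z => vec (fun p => a p z)) y (EuclideanSpace.single k 1)
      = vec (fun p => pd k (a p) y) := by
  have hd : DifferentiableAt ℝ (fun z => vec (fun p => a p z)) y := by
    rw [differentiableAt_euclidean]
    exact h
  refine ⟨hd, ?_⟩
  have h2 : HasFDerivWithinAt (fun z => vec (fun p => a p z)) _ Set.univ y :=
    hd.hasFDerivAt.hasFDerivWithinAt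
  rw [hasFDerivWithinAt_euclidean] at h2
  ext p
  have h3 := (h2 p).hasFDerivAt Filter.univ_mem
  exact (congrArg (fun L : E3 →L[ℝ] ℝ => L (EuclideanSpace.single k 1)) h3.fderiv).symm

/-- the curve in the argument space of `f`. -/
def gam (u : E3 → ℝ) (y : E3) : E3 × ℝ × E3 := (y, u y, grad u y)

/-- its derivative in direction `k`. -/
def gam1 (k : Fin 3) (u : E3 → ℝ) (y : E3) : E3 × ℝ × E3 :=
  (EuclideanSpace.single k 1, pd k u y, vec (fun p => pd k (pd p u) y))

/-- its second derivative in direction `k`. -/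
def gam2 (k : Fin 3) (u : E3 → ℝ) (y : E3) : E3 × ℝ × E3 :=
  (0, pd k (pd k u) y, vec (fun p => pd k (pd k (pd p u)) y))

lemma fderiv_gam {u : E3 → ℝ} {y : E3} (h : ContDiffAt ℝ 3 u y) (k : Fin 3) :
    DifferentiableAt ℝ (gam u) y ∧
    fderiv ℝ (gam u) y (EuclideanSpace.single k 1) = gam1 k u y := by
  have hu : DifferentiableAt ℝ u y := h.differentiableAt (by simp)
  have hp : ∀ p, DifferentiableAt ℝ (pd p u) y := fun p =>
    (pd_contDiffAt 3 2 (by norm_num) h).differentiableAt (by simp)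
  obtain ⟨hd, he⟩ := fderiv_vec hp k
  have hgr : grad u = fun z => vec (fun p => pd p u z) := rfl
  have H := (hasFDerivAt_id y).prodMk (hu.hasFDerivAt.prodMk hd.hasFDerivAt)
  have H' : HasFDerivAt (gam u) _ y := H
  refine ⟨H'.differentiableAt, ?_⟩
  rw [H'.fderiv]
  simp only [gam1, ContinuousLinearMap.prod_apply, he]
  rfl

lemma fderiv_gam1 {u : E3 → ℝ} {y : E3} (h : ContDiffAt ℝ 3 u y) (k : Fin 3) :
    DifferentiableAt ℝ (gam1 k u) y ∧
    fderiv ℝ (gam1 k u) y (EuclideanSpace.single k 1) = gam2 k u y := by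
  have hu : DifferentiableAt ℝ (pd k u) y :=
    (pd_contDiffAt 3 2 (by norm_num) h).differentiableAt (by simp)
  have hp : ∀ p, DifferentiableAt ℝ (pd k (pd p u)) y := fun p =>
    (pd_contDiffAt 2 1 (by norm_num) (pd_contDiffAt 3 2 (by norm_num) h)).differentiableAt (by simp)
  obtain ⟨hd, he⟩ := fderiv_vec hp k
  have H := (hasFDerivAt_const (EuclideanSpace.single k (1:ℝ) : E3) y).prodMk
    (hu.hasFDerivAt.prodMk hd.hasFDerivAt)
  have H' : HasFDerivAt (gam1 k u) _ y := H
  refine ⟨H'.differentiableAt, ?_⟩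
  rw [H'.fderiv]
  simp only [gam2, ContinuousLinearMap.prod_apply, he]
  rfl

lemma pd_F {f : E3 × ℝ × E3 → ℝ} (hf : ContDiff ℝ 2 f) {u : E3 → ℝ} {y : E3}
    (h : ContDiffAt ℝ 3 u y) (k : Fin 3) :
    pd k (fun z => f (z, u z, grad u z)) y = fderiv ℝ f (gam u y) (gam1 k u y) := by
  obtain ⟨h1, h2⟩ := fderiv_gam h k
  have hfd : DifferentiableAt ℝ f (gam u y) := (hf.differentiable (by simp)) _
  have : (fun z => f (z, u z, grad u z)) = f ∘ gam u := rfl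
  rw [this]
  unfold pd
  rw [fderiv_comp _ hfd h1, ContinuousLinearMap.comp_apply, h2]

lemma pd2_F {f : E3 × ℝ × E3 → ℝ} (hf : ContDiff ℝ 2 f) {u : E3 → ℝ} {x : E3}
    (h : ContDiffAt ℝ 3 u x) (k : Fin 3) :
    pd k (pd k (fun z => f (z, u z, grad u z))) x =
      fderiv ℝ (fderiv ℝ f) (gam u x) (gam1 k u x) (gam1 k u x)
      + fderiv ℝ f (gam u x) (gam2 k u x) := by
  have e : pd k (fun z => f (z, u z, grad u z)) =ᶠ[nhds x]
      fun y => fderiv ℝ f (gam u y) (gam1 k u y) := by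
    filter_upwards [h.eventually (by simp)] with y hy using pd_F hf hy k
  rw [(pd_congr e).self_of_nhds]
  obtain ⟨h1, h2⟩ := fderiv_gam h k
  obtain ⟨h3, h4⟩ := fderiv_gam1 h k
  have hfd : DifferentiableAt ℝ (fderiv ℝ f) (gam u x) :=
    ((hf.fderiv_right (m := 1) (by norm_num)).differentiable (by simp)) _
  have hc : HasFDerivAt (fun y => fderiv ℝ f (gam u y)) _ x :=
    hfd.hasFDerivAt.comp x h1.hasFDerivAt
  unfold pd
  rw [(hc.clm_apply h3.hasFDerivAt).fderiv]
  simp [h2, h4]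
  ring

lemma vec_eq_sum (a : Fin 3 → ℝ) : vec a = ∑ p, a p • (EuclideanSpace.single p 1 : E3) := by
  ext q
  fin_cases q <;> simp [vec, Fin.sum_univ_three]

/-- Decomposition and bounds for the derivatives of `F` at a point where the Hessian is diagonal. -/
lemma F_bounds {K : ℝ} (hK : 1 ≤ K) {f : E3 × ℝ × E3 → ℝ} {u : E3 → ℝ} (H : Hyp K f u)
    {x : E3} (hx : x ∈ ball (0 : E3) 10) (hdiag : ∀ i j, i ≠ j → pd i (pd j u) x = 0) (k : Fin 3) :
    (pd k (fun z => f (z, u z, grad u z)) x) ^ 2 ≤ K ^ 2 * (1 + K ^ 2) * (1 + (pd k (pd k u) x) ^ 2)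
    ∧ |pd k (pd k (fun z => f (z, u z, grad u z))) x
        - ∑ p, fp f u p x * pd k (pd k (pd p u)) x|
      ≤ (K * (1 + K ^ 2) + K) * (1 + (pd k (pd k u) x) ^ 2) := by
  obtain ⟨hf, -, hb, hu, -, -, hg⟩ := H
  have hu3 : ContDiffAt ℝ 3 u x :=
    (hu.contDiffAt (isOpen_ball.mem_nhds hx)).of_le le_infty3
  have hK0 : 0 ≤ K := by linarith
  set l := pd k (pd k u) x with hl
  set z := gam u x with hz
  have b1 : ‖fderiv ℝ f z‖ ≤ K := by
    have := hb z 1 (by norm_num)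
    rwa [norm_iteratedFDeriv_one] at this
  have b2 : ‖fderiv ℝ (fderiv ℝ f) z‖ ≤ K := by
    have := hb z 2 (by norm_num)
    rwa [← norm_iteratedFDeriv_fderiv, norm_iteratedFDeriv_one] at this
  have hvec : vec (fun p => pd k (pd p u) x) = l • (EuclideanSpace.single k 1 : E3) := by
    rw [vec_eq_sum, Finset.sum_eq_single k]
    · intro b _ hbk
      rw [hdiag k b (Ne.symm hbk)]; simp
    · simp
  have huk : |pd k u x| ≤ K := by
    have h1 : ‖grad u x k‖ ≤ ‖grad u x‖ := PiLp.norm_apply_le _ _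
    have h2 : grad u x k = pd k u x := rfl
    rw [h2, Real.norm_eq_abs] at h1
    have := hg x hx
    have := abs_nonneg (u x)
    linarith
  have hv : ‖gam1 k u x‖ ^ 2 ≤ (1 + K ^ 2) * (1 + l ^ 2) := by
    have n1 : ‖(EuclideanSpace.single k 1 : E3)‖ = 1 := by simp
    have hn : ‖gam1 k u x‖ = max 1 (max |pd k u x| |l|) := by
      rw [gam1, hvec, Prod.norm_def, Prod.norm_def]
      simp [norm_smul]
    rw [hn]
    have hsq : |pd k u x| ^ 2 ≤ K ^ 2 := by
      apply pow_le_pow_left₀ (abs_nonneg _) huk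
    have := sq_nonneg (K * l)
    rcases max_choice 1 (max |pd k u x| |l|) with h | h
    · rw [h]; nlinarith [sq_nonneg K, sq_nonneg l]
    · rw [h]
      rcases max_choice |pd k u x| |l| with h | h
      · rw [h]; nlinarith [sq_nonneg K, sq_nonneg l]
      · rw [h, sq_abs]; nlinarith [sq_nonneg K, sq_nonneg l]
  constructor
  · rw [pd_F hf hu3, ← sq_abs, ← Real.norm_eq_abs]
    have h1 : ‖fderiv ℝ f z (gam1 k u x)‖ ≤ K * ‖gam1 k u x‖ :=
      (ContinuousLinearMap.le_opNorm _ _).trans (by gcongr)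
    calc ‖fderiv ℝ f z (gam1 k u x)‖ ^ 2 ≤ (K * ‖gam1 k u x‖) ^ 2 := by gcongr
      _ = K ^ 2 * ‖gam1 k u x‖ ^ 2 := by ring
      _ ≤ K ^ 2 * ((1 + K ^ 2) * (1 + l ^ 2)) := by gcongr
      _ = _ := by ring
  · have hsplit : fderiv ℝ f z (gam2 k u x) = l * fderiv ℝ f z (0, 1, 0)
        + ∑ p, fp f u p x * pd k (pd k (pd p u)) x := by
      have : gam2 k u x = l • ((0 : E3), (1 : ℝ), (0 : E3)) +
          ∑ p, pd k (pd k (pd p u)) x • ((0 : E3), (0 : ℝ), (EuclideanSpace.single p 1 : E3)) := by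
        rw [gam2, vec_eq_sum]
        simp [Fin.sum_univ_three, hl]
      rw [this, map_add, map_sum]
      simp only [map_smul, smul_eq_mul, fp]
      congr 1
      apply Finset.sum_congr rfl
      intro p _
      rw [mul_comm]; rfl
    rw [pd2_F hf hu3, hsplit]
    have e : ∀ a b c : ℝ, a + (b + c) - c = a + b := by intros; ring
    rw [e]
    have h1 : ‖fderiv ℝ (fderiv ℝ f) z (gam1 k u x) (gam1 k u x)‖ ≤ K * ‖gam1 k u x‖ ^ 2 := by
      refine (ContinuousLinearMap.le_opNorm₂ _ _ _).trans ?_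
      rw [mul_assoc, ← sq]; gcongr
    have h2 : |fderiv ℝ f z (0, 1, 0)| ≤ K := by
      have := ContinuousLinearMap.le_opNorm (fderiv ℝ f z) ((0 : E3), (1 : ℝ), (0 : E3))
      rw [Real.norm_eq_abs] at this
      have h01 : ‖((0 : E3), (1 : ℝ), (0 : E3))‖ = 1 := by simp [Prod.norm_def]
      rw [h01] at this
      linarith
    have h3 : |l| ≤ 1 + l ^ 2 := by
      rw [← sq_abs]; nlinarith [sq_nonneg (|l| - 1), abs_nonneg l]
    rw [Real.norm_eq_abs] at h1
    calc _ ≤ K * ‖gam1 k u x‖ ^ 2 + |l| * |fderiv ℝ f z (0, 1, 0)| := by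
          refine (abs_add_le _ _).trans ?_
          rw [abs_mul]; gcongr
      _ ≤ K * ((1 + K ^ 2) * (1 + l ^ 2)) + (1 + l ^ 2) * K := by gcongr
      _ = _ := by ring

/-- the quadratic form in the third derivatives for one direction -/
def qf (w1 w2 w3 x1 x2 x3 : ℝ) : ℝ :=
  -(1 / w2 + 1 / w3) * (2 * (x1 * x2 + x1 * x3 + x2 * x3)) + 2 * x2 ^ 2 / w3 + 2 * x3 ^ 2 / w2
    - (x2 + x3) ^ 2 / w1 - w1 * (x1 + x3) ^ 2 / w2 ^ 2 - w1 * (x1 + x2) ^ 2 / w3 ^ 2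

lemma qf_ge {l1 l2 l3 F : ℝ} (x1 x2 x3 : ℝ) (hF : 0 < F) (hFe : F = l1 * l2 + l1 * l3 + l2 * l3)
    (h1 : 0 < l2 + l3) (h2 : 0 < l1 + l3) (h3 : 0 < l1 + l2) :
    -(((l2 + l3) * x1 + (l1 + l3) * x2 + (l1 + l2) * x3) ^ 2 / F
      * (1 / (l1 + l3) + 1 / (l1 + l2))) ≤ qf (l2 + l3) (l1 + l3) (l1 + l2) x1 x2 x3 := by
  have key : qf (l2 + l3) (l1 + l3) (l1 + l2) x1 x2 x3
      + ((l2 + l3) * x1 + (l1 + l3) * x2 + (l1 + l2) * x3) ^ 2 / F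
      * (1 / (l1 + l3) + 1 / (l1 + l2)) = 1 / (l2 + l3) * ((x2 + x3) ^ 2
      + 1 / F * ((2 * F * x2 - ((l2 + l3) * x1 + (l1 + l3) * x2 + (l1 + l2) * x3) * l2) ^ 2
          / (l1 + l2) ^ 2
        + (2 * F * x3 - ((l2 + l3) * x1 + (l1 + l3) * x2 + (l1 + l2) * x3) * l3) ^ 2
          / (l1 + l3) ^ 2)) := by
    unfold qf
    field_simp
    subst hFe
    ring
  have : 0 ≤ 1 / (l2 + l3) * ((x2 + x3) ^ 2
      + 1 / F * ((2 * F * x2 - ((l2 + l3) * x1 + (l1 + l3) * x2 + (l1 + l2) * x3) * l2) ^ 2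
          / (l1 + l2) ^ 2
        + (2 * F * x3 - ((l2 + l3) * x1 + (l1 + l3) * x2 + (l1 + l2) * x3) * l3) ^ 2
          / (l1 + l3) ^ 2)) := by positivity
  linarith

lemma alg_identity {w0 w1 w2 t000 t001 t002 t011 t012 t022 t111 t112 t122 t222 y00 y01 y02 y11 y12 y22 q0 q1 q2 : ℝ}
    (h0 : w0 ≠ 0) (h1 : w1 ≠ 0) (h2 : w2 ≠ 0) :
    w0 * ((y01 + y02) / w0 + (y00 + y02) / w1 + (y00 + y01) / w2
       - (t011 + t022) ^ 2 / w0 ^ 2 - (t000 + t022) ^ 2 / w1 ^ 2 - (t000 + t011) ^ 2 / w2 ^ 2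
       - 2 * t012 ^ 2 / (w1 * w2)
       - 2 * t002 ^ 2 / (w0 * w2)
       - 2 * t001 ^ 2 / (w0 * w1))
    + w1 * ((y11 + y12) / w0 + (y01 + y12) / w1 + (y01 + y11) / w2
       - (t111 + t122) ^ 2 / w0 ^ 2 - (t001 + t122) ^ 2 / w1 ^ 2 - (t001 + t111) ^ 2 / w2 ^ 2
       - 2 * t112 ^ 2 / (w1 * w2)
       - 2 * t012 ^ 2 / (w0 * w2)
       - 2 * t011 ^ 2 / (w0 * w1))
    + w2 * ((y12 + y22) / w0 + (y02 + y22) / w1 + (y02 + y12) / w2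
       - (t112 + t222) ^ 2 / w0 ^ 2 - (t002 + t222) ^ 2 / w1 ^ 2 - (t002 + t112) ^ 2 / w2 ^ 2
       - 2 * t122 ^ 2 / (w1 * w2)
       - 2 * t022 ^ 2 / (w0 * w2)
       - 2 * t012 ^ 2 / (w0 * w1))
    - (q0 * ((t011 + t022) / w0 + (t000 + t022) / w1 + (t000 + t011) / w2)
      + q1 * ((t111 + t122) / w0 + (t001 + t122) / w1 + (t001 + t111) / w2)
      + q2 * ((t112 + t222) / w0 + (t002 + t222) / w1 + (t002 + t112) / w2))
    = (1 / w1 + 1 / w2) * (w0 * y00 + w1 * y01 + w2 * y02 + 2 * (t000 * t011 + t000 * t022 + t011 * t022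
      - t012 ^ 2 - t002 ^ 2 - t001 ^ 2)
        - (q0 * t000 + q1 * t001 + q2 * t002))
      + (1 / w0 + 1 / w2) * (w0 * y01 + w1 * y11 + w2 * y12 + 2 * (t001 * t111 + t001 * t122 + t111 * t122
      - t112 ^ 2 - t012 ^ 2 - t011 ^ 2)
        - (q0 * t011 + q1 * t111 + q2 * t112))
      + (1 / w0 + 1 / w1) * (w0 * y02 + w1 * y12 + w2 * y22 + 2 * (t002 * t112 + t002 * t222 + t112 * t222
      - t122 ^ 2 - t022 ^ 2 - t012 ^ 2)
        - (q0 * t022 + q1 * t122 + q2 * t222))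
      + qf w0 w1 w2 t000 t011 t022 + qf w1 w0 w2 t111 t001 t122 + qf w2 w0 w1 t222 t002 t112
      + 2 * t012 ^ 2 * (2 * (w0 * w1 + w0 * w2 + w1 * w2) - w0 ^ 2 - w1 ^ 2 - w2 ^ 2)
        / (w0 * w1 * w2) := by
  unfold qf
  field_simp
  ring

lemma piece {K A B F l a b R s : ℝ} (hK : 1 ≤ K) (hKF : 1 ≤ K * F) (hA : 0 ≤ A) (hB : 0 ≤ B)
    (ha : 0 < a) (hb : 0 < b) (hF : 0 < F)
    (hab : a * b = F + l ^ 2) (hR : |R| ≤ A * (1 + l ^ 2)) (hs : s ^ 2 ≤ B * (1 + l ^ 2)) :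
    -((A + K * B) * K * (a + b)) ≤ (1 / a + 1 / b) * R - s ^ 2 / F * (1 / a + 1 / b) := by
  have hG : 0 < 1 / a + 1 / b := by positivity
  have hl : 1 + l ^ 2 ≤ K * (a * b) := by rw [hab]; nlinarith [sq_nonneg l]
  have h1 : -(A * (1 + l ^ 2)) ≤ R := (abs_le.1 hR).1
  have h2 : s ^ 2 / F ≤ K * (B * (1 + l ^ 2)) := by
    rw [div_le_iff₀ hF]
    have : 0 ≤ B * (1 + l ^ 2) := by positivity
    nlinarith
  have h3 : -((A + K * B) * (1 + l ^ 2)) ≤ R - s ^ 2 / F := by nlinarith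
  have h4 : -((A + K * B) * (K * (a * b))) ≤ R - s ^ 2 / F := by
    have : (A + K * B) * (1 + l ^ 2) ≤ (A + K * B) * (K * (a * b)) := by gcongr
    linarith
  have h5 := mul_le_mul_of_nonneg_left h4 hG.le
  have e : (1 / a + 1 / b) * -((A + K * B) * (K * (a * b))) = -((A + K * B) * K * (a + b)) := by
    field_simp
    ring
  rw [e] at h5
  linarith

lemma pos_of {l0 l1 l2 F : ℝ} (hF : 0 < F) (hFe : F = l0 * l1 + l0 * l2 + l1 * l2)
    (ht : 0 < l0 + l1 + l2) : 0 < l1 + l2 ∧ 0 < l0 + l2 ∧ 0 < l0 + l1 := by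
  refine ⟨?_, ?_, ?_⟩
  · nlinarith [sq_nonneg l1, sq_nonneg l2, sq_nonneg (l1 + l2)]
  · nlinarith [sq_nonneg l0, sq_nonneg l2, sq_nonneg (l0 + l2)]
  · nlinarith [sq_nonneg l0, sq_nonneg l1, sq_nonneg (l0 + l1)]

/-- the function `V` -/
def VV (f : E3 × ℝ × E3 → ℝ) (u : E3 → ℝ) : E3 → ℝ :=
  fun y => Real.log (f (y, u y, grad u y) * lap u y - (hess u y).det)

lemma sigma2_explicit {u : E3 → ℝ} {y : E3} (hs : ∀ i j, pd i (pd j u) y = pd j (pd i u) y) :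
    sigma2 (hess u y) = pd 0 (pd 0 u) y * pd 1 (pd 1 u) y + pd 0 (pd 0 u) y * pd 2 (pd 2 u) y
      + pd 1 (pd 1 u) y * pd 2 (pd 2 u) y - pd 1 (pd 2 u) y * pd 1 (pd 2 u) y
      - pd 0 (pd 2 u) y * pd 0 (pd 2 u) y - pd 0 (pd 1 u) y * pd 0 (pd 1 u) y := by
  have h1 := hs 1 0
  have h2 := hs 2 0
  have h3 := hs 2 1
  simp only [sigma2, hess, Matrix.trace, Matrix.diag, Matrix.mul_apply, Fin.sum_univ_three,
    Matrix.of_apply, h1, h2, h3]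
  ring

lemma det_explicit {u : E3 → ℝ} {y : E3} (hs : ∀ i j, pd i (pd j u) y = pd j (pd i u) y) :
    sigma2 (hess u y) * lap u y - (hess u y).det =
    (pd 1 (pd 1 u) y + pd 2 (pd 2 u) y) * (pd 0 (pd 0 u) y + pd 2 (pd 2 u) y)
      * (pd 0 (pd 0 u) y + pd 1 (pd 1 u) y)
      - (pd 1 (pd 2 u) y * pd 0 (pd 2 u) y * pd 0 (pd 1 u) y
        + pd 1 (pd 2 u) y * pd 0 (pd 2 u) y * pd 0 (pd 1 u) y)
      - (pd 1 (pd 1 u) y + pd 2 (pd 2 u) y) * (pd 1 (pd 2 u) y * pd 1 (pd 2 u) y)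
      - (pd 0 (pd 0 u) y + pd 2 (pd 2 u) y) * (pd 0 (pd 2 u) y * pd 0 (pd 2 u) y)
      - (pd 0 (pd 0 u) y + pd 1 (pd 1 u) y) * (pd 0 (pd 1 u) y * pd 0 (pd 1 u) y) := by
  rw [sigma2_explicit hs]
  have h1 := hs 1 0
  have h2 := hs 2 0
  have h3 := hs 2 1
  rw [Matrix.det_fin_three]
  simp only [lap, hess, Fin.sum_univ_three, Matrix.of_apply, h1, h2, h3]
  ring

lemma le_infty5 : (5 : WithTop ℕ∞) ≤ ((⊤ : ℕ∞) : WithTop ℕ∞) := by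
  change ((5 : ℕ∞) : WithTop ℕ∞) ≤ _
  exact WithTop.coe_le_coe.2 le_top

section symm
variable {u : E3 → ℝ} {x : E3}

lemma cd4 (h : ContDiffAt ℝ 5 u x) (i : Fin 3) : ContDiffAt ℝ 4 (pd i u) x :=
  pd_contDiffAt 5 4 (by norm_num) h

lemma cd3 (h : ContDiffAt ℝ 5 u x) (i j : Fin 3) : ContDiffAt ℝ 3 (pd i (pd j u)) x :=
  pd_contDiffAt 4 3 (by norm_num) (cd4 h j)

lemma cd2 (h : ContDiffAt ℝ 5 u x) (i j : Fin 3) : ContDiffAt ℝ 2 (pd i (pd j u)) x :=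
  (cd3 h i j).of_le (by norm_num)

lemma sym2 (h : ContDiffAt ℝ 5 u x) (i j : Fin 3) :
    pd i (pd j u) =ᶠ[nhds x] pd j (pd i u) := by
  filter_upwards [h.eventually (by simp)] with y hy
  exact pd_comm (hy.of_le (by norm_num))

/-- swapping the last two indices of a third derivative -/
lemma sym3b (h : ContDiffAt ℝ 5 u x) (i j k : Fin 3) :
    pd i (pd j (pd k u)) x = pd i (pd k (pd j u)) x :=
  (pd_congr (sym2 h j k)).self_of_nhds

/-- swapping the first two indices of a third derivative -/
lemma sym3a (h : ContDiffAt ℝ 5 u x) (i j k : Fin 3) :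
    pd i (pd j (pd k u)) x = pd j (pd i (pd k u)) x :=
  pd_comm ((cd4 h k).of_le (by norm_num))

lemma sym4 (h : ContDiffAt ℝ 5 u x) (i k : Fin 3) :
    pd i (pd i (pd k (pd k u))) x = pd k (pd k (pd i (pd i u))) x := by
  have e1 : pd i (pd k (pd k u)) =ᶠ[nhds x] pd k (pd i (pd k u)) := by
    filter_upwards [h.eventually (by simp)] with y hy
    exact sym3a hy i k k
  have e2 : pd i (pd i (pd k u)) =ᶠ[nhds x] pd k (pd i (pd i u)) := by
    filter_upwards [h.eventually (by simp)] with y hy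
    rw [sym3b hy, sym3a hy]
  rw [(pd_congr e1).self_of_nhds, pd_comm (cd2 h i k), (pd_congr e2).self_of_nhds]

end symm

/-- third derivatives -/
def D3 (u : E3 → ℝ) (x : E3) (k l i : Fin 3) : ℝ := pd i (pd k (pd l u)) x

/-- fourth derivatives -/
def D4 (u : E3 → ℝ) (x : E3) (k i : Fin 3) : ℝ := pd i (pd i (pd k (pd k u))) x

lemma V_eventually {K : ℝ} {f : E3 × ℝ × E3 → ℝ} {u : E3 → ℝ} (H : Hyp K f u)
    {x : E3} (hx : x ∈ ball (0 : E3) 10) : ∀ᶠ y in nhds x,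
      y ∈ ball (0 : E3) 10 ∧ ContDiffAt ℝ 5 u y ∧ ∀ i j, pd i (pd j u) y = pd j (pd i u) y := by
  obtain ⟨hf, -, hb, hu, -, -, hg⟩ := H
  filter_upwards [isOpen_ball.mem_nhds hx] with y hy
  have h5 : ContDiffAt ℝ 5 u y :=
    (hu.contDiffAt (isOpen_ball.mem_nhds hy)).of_le le_infty5
  exact ⟨hy, h5, fun i j => pd_comm (h5.of_le (by norm_num))⟩

/-- jet of `V` at a point with diagonal Hessian -/
lemma V_jet {K : ℝ} {f : E3 × ℝ × E3 → ℝ} {u : E3 → ℝ} (H : Hyp K f u)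
    {x : E3} (hx : x ∈ ball (0 : E3) 10) (hdiag : ∀ i j, i ≠ j → pd i (pd j u) x = 0)
    (h0 : pd 1 (pd 1 u) x + pd 2 (pd 2 u) x ≠ 0) (h1 : pd 0 (pd 0 u) x + pd 2 (pd 2 u) x ≠ 0)
    (h2 : pd 0 (pd 0 u) x + pd 1 (pd 1 u) x ≠ 0) (i : Fin 3) :
    Jet i x (VV f u) (Real.log ((pd 1 (pd 1 u) x + pd 2 (pd 2 u) x) * (pd 0 (pd 0 u) x + pd 2 (pd 2 u) x) * (pd 0 (pd 0 u) x + pd 1 (pd 1 u) x)))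
      ((D3 u x 1 1 i + D3 u x 2 2 i) / (pd 1 (pd 1 u) x + pd 2 (pd 2 u) x) + (D3 u x 0 0 i + D3 u x 2 2 i) / (pd 0 (pd 0 u) x + pd 2 (pd 2 u) x) + (D3 u x 0 0 i + D3 u x 1 1 i) / (pd 0 (pd 0 u) x + pd 1 (pd 1 u) x))
      ((D4 u x 1 i + D4 u x 2 i) / (pd 1 (pd 1 u) x + pd 2 (pd 2 u) x) + (D4 u x 0 i + D4 u x 2 i) / (pd 0 (pd 0 u) x + pd 2 (pd 2 u) x) + (D4 u x 0 i + D4 u x 1 i) / (pd 0 (pd 0 u) x + pd 1 (pd 1 u) x)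
        - (D3 u x 1 1 i + D3 u x 2 2 i) ^ 2 / (pd 1 (pd 1 u) x + pd 2 (pd 2 u) x) ^ 2
        - (D3 u x 0 0 i + D3 u x 2 2 i) ^ 2 / (pd 0 (pd 0 u) x + pd 2 (pd 2 u) x) ^ 2
        - (D3 u x 0 0 i + D3 u x 1 1 i) ^ 2 / (pd 0 (pd 0 u) x + pd 1 (pd 1 u) x) ^ 2
        - 2 * D3 u x 1 2 i ^ 2 / ((pd 0 (pd 0 u) x + pd 2 (pd 2 u) x) * (pd 0 (pd 0 u) x + pd 1 (pd 1 u) x))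
        - 2 * D3 u x 0 2 i ^ 2 / ((pd 1 (pd 1 u) x + pd 2 (pd 2 u) x) * (pd 0 (pd 0 u) x + pd 1 (pd 1 u) x))
        - 2 * D3 u x 0 1 i ^ 2 / ((pd 1 (pd 1 u) x + pd 2 (pd 2 u) x) * (pd 0 (pd 0 u) x + pd 2 (pd 2 u) x))) :=
  have h5 := ((V_eventually H hx).self_of_nhds).2.1
  have D := fun k => Jet.of (i := i) (cd2 h5 k k)
  have O := fun k l (hkl : k ≠ l) =>
    (Jet.of (i := i) (cd2 h5 k l)).congr (Filter.EventuallyEq.refl _ _) (hdiag k l hkl) rfl rfl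
  have e : VV f u =ᶠ[nhds x] _ := by
    filter_upwards [V_eventually H hx] with y hy
    have := H.2.2.2.2.1 y hy.1
    unfold VV
    rw [← this, det_explicit hy.2.2]
  (Jet.logdet ((D 1).add (D 2)) ((D 0).add (D 2)) ((D 0).add (D 1)) (O 1 2 (by decide))
    (O 0 2 (by decide)) (O 0 1 (by decide)) h0 h1 h2).congr e rfl rfl rfl

/-- jet of `F` at a point with diagonal Hessian -/
lemma F_jet {K : ℝ} {f : E3 × ℝ × E3 → ℝ} {u : E3 → ℝ} (H : Hyp K f u)
    {x : E3} (hx : x ∈ ball (0 : E3) 10) (hdiag : ∀ i j, i ≠ j → pd i (pd j u) x = 0)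
    (i : Fin 3) :
    Jet i x (fun z => f (z, u z, grad u z)) (pd 0 (pd 0 u) x * pd 1 (pd 1 u) x + pd 0 (pd 0 u) x * pd 2 (pd 2 u) x + pd 1 (pd 1 u) x * pd 2 (pd 2 u) x)
      ((pd 1 (pd 1 u) x + pd 2 (pd 2 u) x) * D3 u x 0 0 i + (pd 0 (pd 0 u) x + pd 2 (pd 2 u) x) * D3 u x 1 1 i + (pd 0 (pd 0 u) x + pd 1 (pd 1 u) x) * D3 u x 2 2 i)
      ((pd 1 (pd 1 u) x + pd 2 (pd 2 u) x) * D4 u x 0 i + (pd 0 (pd 0 u) x + pd 2 (pd 2 u) x) * D4 u x 1 i + (pd 0 (pd 0 u) x + pd 1 (pd 1 u) x) * D4 u x 2 i + 2 * (D3 u x 0 0 i * D3 u x 1 1 i + D3 u x 0 0 i * D3 u x 2 2 i + D3 u x 1 1 i * D3 u x 2 2 i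
        - D3 u x 1 2 i ^ 2 - D3 u x 0 2 i ^ 2 - D3 u x 0 1 i ^ 2)) :=
  have h5 := ((V_eventually H hx).self_of_nhds).2.1
  have D := fun k => Jet.of (i := i) (cd2 h5 k k)
  have O := fun k l (hkl : k ≠ l) =>
    (Jet.of (i := i) (cd2 h5 k l)).congr (Filter.EventuallyEq.refl _ _) (hdiag k l hkl) rfl rfl
  have e : (fun z => f (z, u z, grad u z)) =ᶠ[nhds x] _ := by
    filter_upwards [V_eventually H hx] with y hy
    have := H.2.2.2.2.1 y hy.1
    rw [← this, sigma2_explicit hy.2.2]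
  (Jet.sig (D 0) (D 1) (D 2) (O 1 2 (by decide))
    (O 0 2 (by decide)) (O 0 1 (by decide))).congr e rfl rfl rfl

lemma qf_ge' {l1 l2 l3 w1 w2 w3 F : ℝ} (x1 x2 x3 : ℝ) (hF : 0 < F)
    (hFe : F = l1 * l2 + l1 * l3 + l2 * l3)
    (h1 : 0 < w1) (h2 : 0 < w2) (h3 : 0 < w3)
    (e1 : w1 = l2 + l3) (e2 : w2 = l1 + l3) (e3 : w3 = l1 + l2) :
    -((w1 * x1 + w2 * x2 + w3 * x3) ^ 2 / F * (1 / w2 + 1 / w3)) ≤ qf w1 w2 w3 x1 x2 x3 := by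
  subst e1 e2 e3
  exact qf_ge x1 x2 x3 hF hFe h1 h2 h3

lemma alg_final {K A B F l0 l1 l2 w0 w1 w2 t000 t001 t002 t011 t012 t022 t111 t112 t122 t222
    y00 y01 y02 y11 y12 y22 q0 q1 q2 : ℝ}
    (hK : 1 ≤ K) (hKF : 1 ≤ K * F) (hA : 0 ≤ A) (hB : 0 ≤ B) (hF : 0 < F)
    (hFe : F = l0 * l1 + l0 * l2 + l1 * l2)
    (hw0 : w0 = l1 + l2) (hw1 : w1 = l0 + l2) (hw2 : w2 = l0 + l1)
    (p0 : 0 < w0) (p1 : 0 < w1) (p2 : 0 < w2)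
    (hf0 : (w0 * t000 + w1 * t011 + w2 * t022) ^ 2 ≤ B * (1 + l0 ^ 2))
    (hg0 : |w0 * y00 + w1 * y01 + w2 * y02 + 2 * (t000 * t011 + t000 * t022 + t011 * t022
      - t012 ^ 2 - t002 ^ 2 - t001 ^ 2)
        - (q0 * t000 + q1 * t001 + q2 * t002)| ≤ A * (1 + l0 ^ 2))
    (hf1 : (w0 * t001 + w1 * t111 + w2 * t122) ^ 2 ≤ B * (1 + l1 ^ 2))
    (hg1 : |w0 * y01 + w1 * y11 + w2 * y12 + 2 * (t001 * t111 + t001 * t122 + t111 * t122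
      - t112 ^ 2 - t012 ^ 2 - t011 ^ 2)
        - (q0 * t011 + q1 * t111 + q2 * t112)| ≤ A * (1 + l1 ^ 2))
    (hf2 : (w0 * t002 + w1 * t112 + w2 * t222) ^ 2 ≤ B * (1 + l2 ^ 2))
    (hg2 : |w0 * y02 + w1 * y12 + w2 * y22 + 2 * (t002 * t112 + t002 * t222 + t112 * t222
      - t122 ^ 2 - t022 ^ 2 - t012 ^ 2)
        - (q0 * t022 + q1 * t122 + q2 * t222)| ≤ A * (1 + l2 ^ 2))
    : -((A + K * B) * K * 4 * (l0 + l1 + l2)) + (q0 * ((t011 + t022) / w0 + (t000 + t022) / w1 + (t000 + t011) / w2)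
      + q1 * ((t111 + t122) / w0 + (t001 + t122) / w1 + (t001 + t111) / w2)
      + q2 * ((t112 + t222) / w0 + (t002 + t222) / w1 + (t002 + t112) / w2)) ≤
    w0 * ((y01 + y02) / w0 + (y00 + y02) / w1 + (y00 + y01) / w2
       - (t011 + t022) ^ 2 / w0 ^ 2 - (t000 + t022) ^ 2 / w1 ^ 2 - (t000 + t011) ^ 2 / w2 ^ 2
       - 2 * t012 ^ 2 / (w1 * w2)
       - 2 * t002 ^ 2 / (w0 * w2)
       - 2 * t001 ^ 2 / (w0 * w1))
    + w1 * ((y11 + y12) / w0 + (y01 + y12) / w1 + (y01 + y11) / w2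
       - (t111 + t122) ^ 2 / w0 ^ 2 - (t001 + t122) ^ 2 / w1 ^ 2 - (t001 + t111) ^ 2 / w2 ^ 2
       - 2 * t112 ^ 2 / (w1 * w2)
       - 2 * t012 ^ 2 / (w0 * w2)
       - 2 * t011 ^ 2 / (w0 * w1))
    + w2 * ((y12 + y22) / w0 + (y02 + y22) / w1 + (y02 + y12) / w2
       - (t112 + t222) ^ 2 / w0 ^ 2 - (t002 + t222) ^ 2 / w1 ^ 2 - (t002 + t112) ^ 2 / w2 ^ 2
       - 2 * t122 ^ 2 / (w1 * w2)
       - 2 * t022 ^ 2 / (w0 * w2)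
       - 2 * t012 ^ 2 / (w0 * w1)) := by
  have id := alg_identity (w0 := w0) (w1 := w1) (w2 := w2) (t000 := t000) (t001 := t001) (t002 := t002) (t011 := t011) (t012 := t012) (t022 := t022) (t111 := t111) (t112 := t112) (t122 := t122) (t222 := t222) (y00 := y00) (y01 := y01) (y02 := y02) (y11 := y11) (y12 := y12) (y22 := y22) (q0 := q0) (q1 := q1) (q2 := q2) p0.ne' p1.ne' p2.ne'
  have Q0 := qf_ge' t000 t011 t022 hF (l1 := l0) (l2 := l1) (l3 := l2) (w1 := w0) (w2 := w1) (w3 := w2)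
    (by linear_combination hFe) p0 p1 p2 (by linear_combination hw0) (by linear_combination hw1) (by linear_combination hw2)
  have P0 := piece (a := w1) (b := w2) (l := l0) (F := F) (s := w0 * t000 + w1 * t011 + w2 * t022) hK hKF hA hB p1 p2 hF
    (by rw [hw1, hw2, hFe]; ring) hg0 hf0
  have S0 : w0 * t000 + w1 * t011 + w2 * t022 = w0 * t000 + w1 * t011 + w2 * t022 := by ring
  rw [S0] at Q0
  have Q1 := qf_ge' t111 t001 t122 hF (l1 := l1) (l2 := l0) (l3 := l2) (w1 := w1) (w2 := w0) (w3 := w2)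
    (by linear_combination hFe) p1 p0 p2 (by linear_combination hw1) (by linear_combination hw0) (by linear_combination hw2)
  have P1 := piece (a := w0) (b := w2) (l := l1) (F := F) (s := w0 * t001 + w1 * t111 + w2 * t122) hK hKF hA hB p0 p2 hF
    (by rw [hw0, hw2, hFe]; ring) hg1 hf1
  have S1 : w1 * t111 + w0 * t001 + w2 * t122 = w0 * t001 + w1 * t111 + w2 * t122 := by ring
  rw [S1] at Q1
  have Q2 := qf_ge' t222 t002 t112 hF (l1 := l2) (l2 := l0) (l3 := l1) (w1 := w2) (w2 := w0) (w3 := w1)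
    (by linear_combination hFe) p2 p0 p1 (by linear_combination hw2) (by linear_combination hw0) (by linear_combination hw1)
  have P2 := piece (a := w0) (b := w1) (l := l2) (F := F) (s := w0 * t002 + w1 * t112 + w2 * t222) hK hKF hA hB p0 p1 hF
    (by rw [hw0, hw1, hFe]; ring) hg2 hf2
  have S2 : w2 * t222 + w0 * t002 + w1 * t112 = w0 * t002 + w1 * t112 + w2 * t222 := by ring
  rw [S2] at Q2
  have ht : 0 ≤ 2 * t012 ^ 2 * (2 * (w0 * w1 + w0 * w2 + w1 * w2) - w0 ^ 2 - w1 ^ 2 - w2 ^ 2)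
        / (w0 * w1 * w2) := by
    have : 2 * (w0 * w1 + w0 * w2 + w1 * w2) - w0 ^ 2 - w1 ^ 2 - w2 ^ 2 = 4 * F := by
      rw [hw0, hw1, hw2, hFe]; ring
    rw [this]; positivity
  have hsum : (A + K * B) * K * (w1 + w2) + (A + K * B) * K * (w0 + w2)
      + (A + K * B) * K * (w0 + w1) = (A + K * B) * K * 4 * (l0 + l1 + l2) := by
    rw [hw0, hw1, hw2]; ring
  linarith

lemma diag_case {K : ℝ} (hK : 1 ≤ K) {f : E3 × ℝ × E3 → ℝ} {u : E3 → ℝ} (H : Hyp K f u)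
    {x : E3} (hx : x ∈ ball (0 : E3) 10) (hdiag : ∀ i j, i ≠ j → pd i (pd j u) x = 0) :
    - (((K * (1 + K ^ 2) + K) + K * (K ^ 2 * (1 + K ^ 2))) * K * 4) * lap u x
      + ∑ i, fp f u i x * pd i (VV f u) x ≤
    ∑ i, ∑ j, sg u x i j * pd i (pd j (VV f u)) x := by
  have h5 := ((V_eventually H hx).self_of_nhds).2.1
  have sA : ∀ a b c, D3 u x a b c = D3 u x b a c := fun a b c => sym3b h5 c a b
  have sB : ∀ a b c, D3 u x a b c = D3 u x a c b := fun a b c => by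
    rw [sA a b c, sA a c b]
    unfold D3
    rw [sym3a h5 c b a]
  have c010 : D3 u x 0 1 0 = D3 u x 0 0 1 := (sB 0 1 0)
  have c020 : D3 u x 0 2 0 = D3 u x 0 0 2 := (sB 0 2 0)
  have c021 : D3 u x 0 2 1 = D3 u x 0 1 2 := (sB 0 2 1)
  have c100 : D3 u x 1 0 0 = D3 u x 0 0 1 := ((sA 1 0 0).trans (sB 0 1 0))
  have c101 : D3 u x 1 0 1 = D3 u x 0 1 1 := (sA 1 0 1)
  have c102 : D3 u x 1 0 2 = D3 u x 0 1 2 := (sA 1 0 2)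
  have c110 : D3 u x 1 1 0 = D3 u x 0 1 1 := ((sB 1 1 0).trans (sA 1 0 1))
  have c120 : D3 u x 1 2 0 = D3 u x 0 1 2 := ((sB 1 2 0).trans (sA 1 0 2))
  have c121 : D3 u x 1 2 1 = D3 u x 1 1 2 := (sB 1 2 1)
  have c200 : D3 u x 2 0 0 = D3 u x 0 0 2 := ((sA 2 0 0).trans (sB 0 2 0))
  have c201 : D3 u x 2 0 1 = D3 u x 0 1 2 := ((sA 2 0 1).trans (sB 0 2 1))
  have c202 : D3 u x 2 0 2 = D3 u x 0 2 2 := (sA 2 0 2)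
  have c210 : D3 u x 2 1 0 = D3 u x 0 1 2 := ((sA 2 1 0).trans ((sB 1 2 0).trans (sA 1 0 2)))
  have c211 : D3 u x 2 1 1 = D3 u x 1 1 2 := ((sA 2 1 1).trans (sB 1 2 1))
  have c212 : D3 u x 2 1 2 = D3 u x 1 2 2 := (sA 2 1 2)
  have c220 : D3 u x 2 2 0 = D3 u x 0 2 2 := ((sB 2 2 0).trans (sA 2 0 2))
  have c221 : D3 u x 2 2 1 = D3 u x 1 2 2 := ((sB 2 2 1).trans (sA 2 1 2))
  have d10 : D4 u x 1 0 = D4 u x 0 1 := sym4 h5 0 1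
  have d20 : D4 u x 2 0 = D4 u x 0 2 := sym4 h5 0 2
  have d21 : D4 u x 2 1 = D4 u x 1 2 := sym4 h5 1 2
  have hlap : lap u x = pd 0 (pd 0 u) x + pd 1 (pd 1 u) x + pd 2 (pd 2 u) x := by
    simp [lap, hess, Fin.sum_univ_three]
  have hFv : f (x, u x, grad u x) = _ := (F_jet H hx hdiag 0).v
  have hFK : 1 / K ≤ f (x, u x, grad u x) := H.2.1 _
  have hK0 : 0 < K := by linarith
  have hF : 0 < f (x, u x, grad u x) := lt_of_lt_of_le (by positivity) hFK
  have hKF : 1 ≤ K * f (x, u x, grad u x) := by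
    rw [div_le_iff₀ hK0] at hFK; linarith
  have hlp := H.2.2.2.2.2.1 x hx
  rw [hlap] at hlp
  obtain ⟨p0, p1, p2⟩ := pos_of hF hFv hlp
  have v1 := fun i => (V_jet H hx hdiag p0.ne' p1.ne' p2.ne' i).d
  have v2 := fun i => (V_jet H hx hdiag p0.ne' p1.ne' p2.ne' i).dd
  have bd := fun k => F_bounds hK H hx hdiag k
  have f1 := fun i => (F_jet H hx hdiag i).d
  have f2 := fun i => (F_jet H hx hdiag i).dd
  have bd' : ∀ k, _ ∧ |_ - ∑ p, fp f u p x * D3 u x k p k| ≤ _ := bd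
  simp only [f1, f2] at bd'
  have sgd : ∀ i j, i ≠ j → sg u x i j = 0 := by
    intro i j hij
    simp [sg, hess, hdiag i j hij, Matrix.one_apply_ne hij]
  have s0 : sg u x 0 0 = pd 1 (pd 1 u) x + pd 2 (pd 2 u) x := by
    simp [sg, hlap, hess]; ring
  have s1 : sg u x 1 1 = pd 0 (pd 0 u) x + pd 2 (pd 2 u) x := by
    simp [sg, hlap, hess]; ring
  have s2 : sg u x 2 2 = pd 0 (pd 0 u) x + pd 1 (pd 1 u) x := by
    simp [sg, hlap, hess]
  obtain ⟨b0, g0⟩ := bd' 0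
  obtain ⟨b1, g1⟩ := bd' 1
  obtain ⟨b2, g2⟩ := bd' 2
  simp only [Fin.sum_univ_three, c010, c020, c021, c100, c101, c102, c110, c120, c121, c200, c201, c202, c210, c211, c212, c220, c221, d10, d20, d21] at b0 g0 b1 g1 b2 g2
  rw [hlap]
  simp only [Fin.sum_univ_three, sgd 0 1 (by decide), sgd 0 2 (by decide), sgd 1 0 (by decide),
    sgd 1 2 (by decide), sgd 2 0 (by decide), sgd 2 1 (by decide), s0, s1, s2, v1, v2,
    zero_mul, add_zero, zero_add, c010, c020, c021, c100, c101, c102, c110, c120, c121, c200, c201, c202, c210, c211, c212, c220, c221, d10, d20, d21]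
  have fin := alg_final hK hKF (by positivity) (by positivity) hF hFv rfl rfl rfl p0 p1 p2
    b0 g0 b1 g1 b2 g2
  rw [neg_mul]
  exact fin

section rot
variable (O : E3 ≃ₗᵢ[ℝ] E3)

/-- matrix of the rotation -/
def rm : Matrix (Fin 3) (Fin 3) ℝ := Matrix.of fun j i => (O (EuclideanSpace.single i 1)) j

lemma rm_orth : (rm O).transpose * rm O = 1 := by
  ext i k
  have h : inner ℝ (O (EuclideanSpace.single i (1:ℝ))) (O (EuclideanSpace.single k (1:ℝ)))
      = inner ℝ (EuclideanSpace.single i (1:ℝ) : E3) (EuclideanSpace.single k (1:ℝ)) :=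
    O.inner_map_map _ _
  rw [PiLp.inner_apply] at h
  simp only [Matrix.mul_apply, Matrix.transpose_apply, rm, Matrix.of_apply]
  have h2 : inner ℝ (EuclideanSpace.single i (1:ℝ) : E3) (EuclideanSpace.single k (1:ℝ))
      = (1 : Matrix (Fin 3) (Fin 3) ℝ) i k := by
    by_cases hik : i = k
    · subst hik; simp
    · rw [Matrix.one_apply_ne hik, EuclideanSpace.inner_single_left]
      simp [hik]
  rw [← h2, ← h]
  apply Finset.sum_congr rfl
  intro j _
  simp [mul_comm]

lemma rm_orth' : rm O * (rm O).transpose = 1 := mul_eq_one_comm.1 (rm_orth O)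

lemma O_single (i : Fin 3) :
    O (EuclideanSpace.single i 1) = ∑ j, rm O j i • (EuclideanSpace.single j 1 : E3) := by
  have := vec_eq_sum (fun j => rm O j i)
  rw [← this]
  ext j
  simp [vec, rm]

lemma pd_comp (g : E3 → ℝ) (i : Fin 3) (y : E3) :
    pd i (fun z => g (O z)) y = ∑ j, rm O j i * pd j g (O y) := by
  unfold pd
  have h : fderiv ℝ (fun z => g (O z)) y = (fderiv ℝ g (O y)).comp
      (O.toContinuousLinearEquiv : E3 →L[ℝ] E3) := O.toContinuousLinearEquiv.comp_right_fderiv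
  rw [h]
  have h2 : ((O.toContinuousLinearEquiv : E3 →L[ℝ] E3)) (EuclideanSpace.single i 1)
    = O (EuclideanSpace.single i 1) := rfl
  rw [ContinuousLinearMap.comp_apply, h2, O_single, map_sum]
  simp

lemma hess_comp {g : E3 → ℝ} {y : E3} (hg : ContDiffAt ℝ 2 g (O y)) :
    hess (fun z => g (O z)) y = (rm O).transpose * hess g (O y) * rm O := by
  ext i j
  have e : pd j (fun z => g (O z)) = fun y => ∑ l, rm O l j * pd l g (O y) := by
    funext y; exact pd_comp O g j y
  simp only [hess, Matrix.of_apply, e, Fin.sum_univ_three]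
  have hd : ∀ l, DifferentiableAt ℝ (fun y => rm O l j * pd l g (O y)) y := fun l =>
    (DifferentiableAt.comp y hg.pdDiff O.differentiable.differentiableAt).const_mul _
  have hm : ∀ l, pd i (fun y => rm O l j * pd l g (O y)) y =
      rm O l j * ∑ k, rm O k i * pd k (pd l g) (O y) := by
    intro l
    rw [← pd_comp]
    have hh : DifferentiableAt ℝ (fun y => pd l g (O y)) y :=
      DifferentiableAt.comp y hg.pdDiff O.differentiable.differentiableAt
    unfold pd at hh ⊢
    rw [fderiv_const_mul hh]
    rfl
  rw [pd_add ((hd 0).fun_add (hd 1)) (hd 2), pd_add (hd 0) (hd 1), hm, hm, hm]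
  simp only [Matrix.mul_apply, Fin.sum_univ_three, Matrix.transpose_apply, Matrix.of_apply]
  ring

lemma grad_comp (g : E3 → ℝ) (y : E3) : O (grad (fun z => g (O z)) y) = grad g (O y) := by
  have h1 : grad (fun z => g (O z)) y = vec (fun i => ∑ j, rm O j i * pd j g (O y)) := by
    unfold grad vec
    congr 1
    funext i
    exact pd_comp O g i y
  have h2 : grad g (O y) = vec (fun i => pd i g (O y)) := rfl
  rw [h1, h2, vec_eq_sum, vec_eq_sum, map_sum]
  simp only [map_smul, O_single]
  have ho := rm_orth' O
  have hc : ∀ a b, ∑ i, rm O a i * rm O b i = (1 : Matrix (Fin 3) (Fin 3) ℝ) a b := by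
    intro a b
    rw [← ho]; simp [Matrix.mul_apply]
  rw [← vec_eq_sum]
  ext k
  have hc0 := hc k 0
  have hc1 := hc k 1
  have hc2 := hc k 2
  simp only [Fin.sum_univ_three] at hc0 hc1 hc2 ⊢
  simp only [PiLp.add_apply, PiLp.smul_apply, smul_eq_mul]
  fin_cases k <;> simp [vec, Matrix.one_apply] at hc0 hc1 hc2 ⊢ <;>
  linear_combination (pd 0 g (O y)) * hc0 + (pd 1 g (O y)) * hc1 + (pd 2 g (O y)) * hc2

lemma trace_conj (A : Matrix (Fin 3) (Fin 3) ℝ) :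
    ((rm O).transpose * A * rm O).trace = A.trace := by
  rw [Matrix.trace_mul_comm, ← mul_assoc, rm_orth', one_mul]

lemma rot_conj_mul (A B : Matrix (Fin 3) (Fin 3) ℝ) :
    ((rm O).transpose * A * rm O) * ((rm O).transpose * B * rm O)
      = (rm O).transpose * (A * B) * rm O := by
  calc _ = (rm O).transpose * A * (rm O * (rm O).transpose) * B * rm O := by
        simp only [mul_assoc]
    _ = _ := by rw [rm_orth']; simp only [mul_assoc, mul_one, one_mul]

lemma det_conj (A : Matrix (Fin 3) (Fin 3) ℝ) :
    ((rm O).transpose * A * rm O).det = A.det := by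
  have h := congrArg Matrix.det (rm_orth O)
  rw [Matrix.det_mul, Matrix.det_one] at h
  rw [Matrix.det_mul, Matrix.det_mul]
  linear_combination A.det * h

lemma sigma2_conj (A : Matrix (Fin 3) (Fin 3) ℝ) :
    sigma2 ((rm O).transpose * A * rm O) = sigma2 A := by
  unfold sigma2
  rw [rot_conj_mul, trace_conj, trace_conj]

lemma lap_comp {g : E3 → ℝ} {y : E3} (hg : ContDiffAt ℝ 2 g (O y)) :
    lap (fun z => g (O z)) y = lap g (O y) := by
  have h := trace_conj O (hess g (O y))
  rw [← hess_comp O hg] at h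
  exact h

/-- rotation of the arguments of `f`. -/
def rotE : (E3 × ℝ × E3) ≃ₗᵢ[ℝ] (E3 × ℝ × E3) where
  toLinearEquiv := O.toLinearEquiv.prodCongr
    ((LinearEquiv.refl ℝ ℝ).prodCongr O.toLinearEquiv)
  norm_map' := by
    rintro ⟨a, b, c⟩
    simp [Prod.norm_def]

lemma rotE_apply (a : E3) (b : ℝ) (c : E3) : rotE O (a, b, c) = (O a, b, O c) := rfl

lemma f_comp (f : E3 × ℝ × E3 → ℝ) (u : E3 → ℝ) (y : E3) :
    (fun z => f (rotE O z)) (y, (fun z => u (O z)) y, grad (fun z => u (O z)) y)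
      = f (O y, u (O y), grad u (O y)) := by
  simp only [rotE_apply, grad_comp]

lemma fp_comp (f : E3 × ℝ × E3 → ℝ) (u : E3 → ℝ) (i : Fin 3) (y : E3) :
    fp (fun z => f (rotE O z)) (fun z => u (O z)) i y = ∑ j, rm O j i * fp f u j (O y) := by
  unfold fp
  have h : ∀ z, fderiv ℝ (fun z => f (rotE O z)) z = (fderiv ℝ f (rotE O z)).comp
      ((rotE O).toContinuousLinearEquiv : (E3 × ℝ × E3) →L[ℝ] (E3 × ℝ × E3)) := fun z =>
    (rotE O).toContinuousLinearEquiv.comp_right_fderiv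
  rw [h, rotE_apply, grad_comp, ContinuousLinearMap.comp_apply]
  have h2 : ((rotE O).toContinuousLinearEquiv : (E3 × ℝ × E3) →L[ℝ] (E3 × ℝ × E3))
      ((0 : E3), (0 : ℝ), (EuclideanSpace.single i 1 : E3)) =
      ∑ j, rm O j i • ((0 : E3), (0 : ℝ), (EuclideanSpace.single j 1 : E3)) := by
    change rotE O _ = _
    rw [rotE_apply, O_single]
    simp [Fin.sum_univ_three]
  rw [h2, map_sum]
  simp only [map_smul, smul_eq_mul]

lemma ball_comp {r : ℝ} {y : E3} (hy : y ∈ ball (0 : E3) r) : O y ∈ ball (0 : E3) r := by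
  simpa using hy

lemma Hyp_comp {K : ℝ} {f : E3 × ℝ × E3 → ℝ} {u : E3 → ℝ} (H : Hyp K f u) :
    Hyp K (fun z => f (rotE O z)) (fun z => u (O z)) := by
  obtain ⟨hf, hl, hb, hu, hs, hp, hg⟩ := H
  have cd : ∀ y ∈ ball (0 : E3) 10, ContDiffAt ℝ 2 u (O y) := fun y hy =>
    (hu.contDiffAt (isOpen_ball.mem_nhds (ball_comp O hy))).of_le
      (le_trans (by norm_num) le_infty5)
  refine ⟨hf.comp (rotE O).contDiff, fun z => hl _, fun z k hk => ?_, ?_, fun y hy => ?_,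
    fun y hy => ?_, fun y hy => ?_⟩
  · have := (rotE O).norm_iteratedFDeriv_comp_right (𝕜 := ℝ) f z k
    change ‖iteratedFDeriv ℝ k (f ∘ rotE O) z‖ ≤ K
    rw [this]
    exact hb _ k hk
  · exact hu.comp O.contDiff.contDiffOn (fun y hy => ball_comp O hy)
  · rw [f_comp, hess_comp O (cd y hy), sigma2_conj]
    exact hs _ (ball_comp O hy)
  · rw [lap_comp O (cd y hy)]
    exact hp _ (ball_comp O hy)
  · have := hg _ (ball_comp O hy)
    rw [← grad_comp, O.norm_map] at this
    exact this

lemma V_comp {K : ℝ} {f : E3 × ℝ × E3 → ℝ} {u : E3 → ℝ} (H : Hyp K f u) {y : E3}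
    (hy : y ∈ ball (0 : E3) 10) :
    VV (fun z => f (rotE O z)) (fun z => u (O z)) y = VV f u (O y) := by
  obtain ⟨hf, hl, hb, hu, hs, hp, hg⟩ := H
  have cd : ContDiffAt ℝ 2 u (O y) :=
    (hu.contDiffAt (isOpen_ball.mem_nhds (ball_comp O hy))).of_le
      (le_trans (by norm_num) le_infty5)
  unfold VV
  rw [f_comp, lap_comp O cd, hess_comp O cd, det_conj]

end rot

lemma sum_trace (A B : Matrix (Fin 3) (Fin 3) ℝ) :
    ∑ i, ∑ j, A i j * B i j = (A.transpose * B).trace := by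
  simp only [Matrix.trace, Matrix.diag, Matrix.mul_apply, Matrix.transpose_apply]
  exact Finset.sum_comm

lemma diagonalize (A : Matrix (Fin 3) (Fin 3) ℝ) (hA : A.IsHermitian) :
    ∃ O : E3 ≃ₗᵢ[ℝ] E3, ∀ i j, i ≠ j → ((rm O).transpose * A * rm O) i j = 0 := by
  refine ⟨hA.eigenvectorBasis.repr.symm, fun i j hij => ?_⟩
  set O := hA.eigenvectorBasis.repr.symm with hO
  have hb : ∀ k, O (EuclideanSpace.single k 1) = hA.eigenvectorBasis k := by
    intro k; simp [hO]
  have hcol : A * rm O = rm O * Matrix.diagonal hA.eigenvalues := by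
    ext a k
    have h := congrFun (hA.mulVec_eigenvectorBasis k) a
    rw [Matrix.mul_diagonal]
    have h1 : rm O a k = (hA.eigenvectorBasis k) a := by simp [rm, hb]
    rw [h1, Matrix.mul_apply]
    simp only [Matrix.mulVec, dotProduct] at h
    simp only [rm, Matrix.of_apply, hb]
    rw [h]
    simp [mul_comm]
  rw [mul_assoc, hcol, ← mul_assoc, rm_orth, one_mul, Matrix.diagonal_apply_ne _ hij]

theorem stmt_8 :
    ∀ K : ℝ, 1 ≤ K → ∃ C : ℝ, 0 < C ∧
      ∀ (f : E3 × ℝ × E3 → ℝ) (u : E3 → ℝ), Hyp K f u →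
        ∀ x ∈ ball (0 : E3) 4,
          ∑ i, ∑ j, sg u x i j *
              pd i (pd j (fun y => Real.log (f (y, u y, grad u y) * lap u y - (hess u y).det))) x ≥
            - C * lap u x
              + ∑ i, fp f u i x *
                  pd i (fun y => Real.log (f (y, u y, grad u y) * lap u y - (hess u y).det)) x := by
  intro K hK
  refine ⟨((K * (1 + K ^ 2) + K) + K * (K ^ 2 * (1 + K ^ 2))) * K * 4, by positivity, ?_⟩
  intro f u H x hx4
  have hx : x ∈ ball (0 : E3) 10 := ball_subset_ball (by norm_num) hx4
  have hsym := ((V_eventually H hx).self_of_nhds).2.2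
  have h5 := ((V_eventually H hx).self_of_nhds).2.1
  have hA : (hess u x).IsHermitian := by
    ext i j
    simp [hess, hsym j i]
  obtain ⟨O, hO⟩ := diagonalize _ hA
  obtain ⟨x', rfl⟩ : ∃ x', O x' = x := O.surjective x
  have hx' : x' ∈ ball (0 : E3) 10 := by simpa using hx
  have cdu : ContDiffAt ℝ 2 u (O x') := h5.of_le (by norm_num)
  rw [← hess_comp O cdu] at hO
  have H' := Hyp_comp O H
  have main := diag_case hK H' hx' hO
  have eV : VV (fun z => f (rotE O z)) (fun z => u (O z)) =ᶠ[nhds x'] fun y => VV f u (O y) := by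
    filter_upwards [isOpen_ball.mem_nhds hx'] with y hy using V_comp O H hy
  have hlp := H.2.2.2.2.2.1 _ hx
  have cdV : ContDiffAt ℝ 2 (VV f u) (O x') := by
    have hl' := H'.2.2.2.2.2.1 _ hx'
    have hFv := (F_jet H' hx' hO 0).v
    have hF : 0 < f (rotE O (x', u (O x'), grad (fun z => u (O z)) x')) :=
      lt_of_lt_of_le (by positivity) (H.2.1 _)
    have hlap : lap (fun z => u (O z)) x' = pd 0 (pd 0 (fun z => u (O z))) x'
        + pd 1 (pd 1 (fun z => u (O z))) x' + pd 2 (pd 2 (fun z => u (O z))) x' := by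
      simp [lap, hess, Fin.sum_univ_three]
    rw [hlap] at hl'
    obtain ⟨p0, p1, p2⟩ := pos_of hF hFv hl'
    have c1 := (V_jet H' hx' hO p0.ne' p1.ne' p2.ne' 0).cd.congr_of_eventuallyEq eV.symm
    have c2 : ContDiffAt ℝ 2 (fun y => VV f u (O y)) (O.symm (O x')) := by
      rw [O.symm_apply_apply]; exact c1
    have c3 := c2.comp (O x') O.symm.contDiff.contDiffAt
    have e : (fun y => VV f u (O y)) ∘ O.symm = VV f u := by
      funext z; simp
    rwa [e] at c3
  have e1 : ∀ i, pd i (VV (fun z => f (rotE O z)) (fun z => u (O z))) x'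
      = ∑ j, rm O j i * pd j (VV f u) (O x') := by
    intro i
    rw [(pd_congr eV).self_of_nhds, pd_comp]
  have e2 : hess (VV (fun z => f (rotE O z)) (fun z => u (O z))) x'
      = (rm O).transpose * hess (VV f u) (O x') * rm O := by
    rw [← hess_comp O cdV]
    ext i j
    exact (pd_congr (pd_congr eV)).self_of_nhds
  have e3 : sg (fun z => u (O z)) x' = (rm O).transpose * sg u (O x') * rm O := by
    unfold sg
    rw [hess_comp O cdu, lap_comp O cdu, mul_sub, sub_mul, mul_smul_comm, smul_mul_assoc, mul_one,
      rm_orth]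
  have l1 : ∑ i, ∑ j, sg (fun z => u (O z)) x' i j *
      pd i (pd j (VV (fun z => f (rotE O z)) (fun z => u (O z)))) x'
      = ∑ i, ∑ j, sg u (O x') i j * pd i (pd j (VV f u)) (O x') := by
    have a1 := sum_trace (sg (fun z => u (O z)) x')
      (hess (VV (fun z => f (rotE O z)) (fun z => u (O z))) x')
    have a2 := sum_trace (sg u (O x')) (hess (VV f u) (O x'))
    have a3 : ((sg (fun z => u (O z)) x').transpose
        * hess (VV (fun z => f (rotE O z)) (fun z => u (O z))) x').trace
        = ((sg u (O x')).transpose * hess (VV f u) (O x')).trace := by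
      rw [e2, e3]
      have : ((rm O).transpose * sg u (O x') * rm O).transpose
          = (rm O).transpose * (sg u (O x')).transpose * rm O := by
        simp [Matrix.transpose_mul, mul_assoc]
      rw [this, rot_conj_mul, trace_conj]
    exact a1.trans (a3.trans a2.symm)
  have l2 : ∑ i, fp (fun z => f (rotE O z)) (fun z => u (O z)) i x'
        * pd i (VV (fun z => f (rotE O z)) (fun z => u (O z))) x'
      = ∑ i, fp f u i (O x') * pd i (VV f u) (O x') := by
    simp only [e1, fp_comp]
    have hc : ∀ a b, ∑ i, rm O a i * rm O b i = (1 : Matrix (Fin 3) (Fin 3) ℝ) a b := by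
      intro a b
      rw [← rm_orth' O]; simp [Matrix.mul_apply]
    have c00 := hc 0 0
    have c01 := hc 0 1
    have c02 := hc 0 2
    have c11 := hc 1 1
    have c12 := hc 1 2
    have c22 := hc 2 2
    simp [Fin.sum_univ_three] at c00 c01 c02 c11 c12 c22
    simp only [Fin.sum_univ_three]
    generalize pd 0 (VV f u) (O x') = b0
    generalize pd 1 (VV f u) (O x') = b1
    generalize pd 2 (VV f u) (O x') = b2
    generalize fp f u 0 (O x') = a0
    generalize fp f u 1 (O x') = a1
    generalize fp f u 2 (O x') = a2
    linear_combination a0 * b0 * c00 + a1 * b1 * c11 + a2 * b2 * c22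
      + (a0 * b1 + a1 * b0) * c01 + (a0 * b2 + a2 * b0) * c02 + (a1 * b2 + a2 * b1) * c12
  rw [l1, l2, lap_comp O cdu] at main
  exact main
end
end

section
/- For every K ≥ 1 there exists C > 0 depending only on K with the following property. Assume f : ℝ³ × ℝ × ℝ³ → ℝ is of class C² with f ≥ 1/K everywhere and with |f| and all partial derivatives of f up to order 2 bounded by K; u : ℝ³ → ℝ is C^∞ on B₁₀ with σ₂(D²u(x)) = f(x, u(x), Du(x)) and Δu(x) > 0 on B₁₀; and |u(x)| + |Du(x)| ≤ K on B₁₀. Set F(x) := f(x, u(x), Du(x)), G(x) := F(x)·Δu(x) − det D²u(x) > 0, and M₅ := sup_{B₅} Δu. If M₅ ≥ C, then for every x ∈ B₄ with G(x) ≥ C one has G(x) ≤ C · (M₅ / (log M₅)^{1/2}) · log G(x). -/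
open Metric MeasureTheory Real

noncomputable section

open Filter Topology

/-- `φ` has second-order jet `(a, b, c)` at `0`. -/
def J2 (φ : ℝ → ℝ) (a b c : ℝ) : Prop :=
  φ 0 = a ∧ ∃ φ' : ℝ → ℝ, (∀ᶠ t in 𝓝 (0:ℝ), HasDerivAt φ (φ' t) t) ∧ φ' 0 = b ∧
    HasDerivAt φ' c 0

lemma J2.congr {φ ψ : ℝ → ℝ} {a b c : ℝ} (h : J2 φ a b c) (e : ψ =ᶠ[𝓝 0] φ) : J2 ψ a b c := by
  obtain ⟨h0, φ', h1, h2, h3⟩ := h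
  refine ⟨by rw [e.eq_of_nhds, h0], φ', ?_, h2, h3⟩
  filter_upwards [h1, e.eventuallyEq_nhds] with t ht he
  exact ht.congr_of_eventuallyEq he

lemma J2.unique {φ : ℝ → ℝ} {a b c a' b' c' : ℝ} (h : J2 φ a b c) (h' : J2 φ a' b' c') :
    a = a' ∧ b = b' ∧ c = c' := by
  obtain ⟨h0, φ', h1, h2, h3⟩ := h
  obtain ⟨k0, ψ', k1, k2, k3⟩ := h'
  have e : φ' =ᶠ[𝓝 0] ψ' := by
    filter_upwards [h1, k1] with t ht kt
    exact ht.unique kt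
  exact ⟨h0.symm.trans k0, by rw [← h2, ← k2, e.eq_of_nhds],
    h3.unique (k3.congr_of_eventuallyEq e)⟩

lemma J2.const (a : ℝ) : J2 (fun _ => a) a 0 0 :=
  ⟨rfl, fun _ => 0, Eventually.of_forall fun t => hasDerivAt_const t a, rfl, hasDerivAt_const 0 0⟩

lemma J2.cast {φ : ℝ → ℝ} {a b c a' b' c' : ℝ} (h : J2 φ a b c) (ha : a = a') (hb : b = b')
    (hc : c = c') : J2 φ a' b' c' := by
  subst ha hb hc; exact h

lemma J2.add {φ ψ : ℝ → ℝ} {a b c a' b' c' : ℝ} (h : J2 φ a b c) (h' : J2 ψ a' b' c') :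
    J2 (fun t => φ t + ψ t) (a + a') (b + b') (c + c') := by
  obtain ⟨h0, φ', h1, h2, h3⟩ := h
  obtain ⟨k0, ψ', k1, k2, k3⟩ := h'
  refine ⟨by simp only [h0, k0], fun t => φ' t + ψ' t, ?_, by simp only [h2, k2], h3.add k3⟩
  filter_upwards [h1, k1] with t ht kt
  exact ht.add kt

lemma J2.sub {φ ψ : ℝ → ℝ} {a b c a' b' c' : ℝ} (h : J2 φ a b c) (h' : J2 ψ a' b' c') :
    J2 (fun t => φ t - ψ t) (a - a') (b - b') (c - c') := by
  obtain ⟨h0, φ', h1, h2, h3⟩ := h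
  obtain ⟨k0, ψ', k1, k2, k3⟩ := h'
  refine ⟨by simp only [h0, k0], fun t => φ' t - ψ' t, ?_, by simp only [h2, k2], h3.sub k3⟩
  filter_upwards [h1, k1] with t ht kt
  exact ht.sub kt

lemma J2.mul {φ ψ : ℝ → ℝ} {a b c a' b' c' : ℝ} (h : J2 φ a b c) (h' : J2 ψ a' b' c') :
    J2 (fun t => φ t * ψ t) (a * a') (b * a' + a * b') (c * a' + 2 * b * b' + a * c') := by
  obtain ⟨h0, φ', h1, h2, h3⟩ := h
  obtain ⟨k0, ψ', k1, k2, k3⟩ := h'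
  refine ⟨by simp only [h0, k0], fun t => φ' t * ψ t + φ t * ψ' t, ?_, by simp only [h2, k2, h0, k0], ?_⟩
  · filter_upwards [h1, k1] with t ht kt
    exact ht.mul kt
  · have := (h3.mul k1.self_of_nhds).add (h1.self_of_nhds.mul k3)
    refine HasDerivAt.congr_deriv (f := fun t => φ' t * ψ t + φ t * ψ' t) this ?_
    rw [h0, k0, h2, k2]; ring

lemma J2.log {φ : ℝ → ℝ} {a b c : ℝ} (h : J2 φ a b c) (ha : 0 < a) :
    J2 (fun t => Real.log (φ t)) (Real.log a) (b / a) (c / a - (b / a) ^ 2) := by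
  obtain ⟨h0, φ', h1, h2, h3⟩ := h
  have hc : ContinuousAt φ 0 := h1.self_of_nhds.continuousAt
  have hp : ∀ᶠ t in 𝓝 (0:ℝ), 0 < φ t := hc.eventually (lt_mem_nhds (by rw [h0]; exact ha))
  refine ⟨by simp only [h0], fun t => φ' t / φ t, ?_, by simp only [h0, h2], ?_⟩
  · filter_upwards [h1, hp] with t ht hpt
    exact ht.log hpt.ne'
  · have := h3.div h1.self_of_nhds (by rw [h0]; exact ha.ne')
    refine HasDerivAt.congr_deriv (f := fun t => φ' t / φ t) this ?_
    rw [h0, h2]; field_simp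

lemma J2.max {φ : ℝ → ℝ} {a b c : ℝ} (h : J2 φ a b c) (hm : IsLocalMax φ 0) : b = 0 ∧ c ≤ 0 := by
  obtain ⟨h0, φ', h1, h2, h3⟩ := h
  have hb : b = 0 := by
    rw [← h2]; exact hm.hasDerivAt_eq_zero h1.self_of_nhds
  refine ⟨hb, ?_⟩
  by_contra hcon
  push Not at hcon
  have e1 : deriv φ =ᶠ[𝓝 0] φ' := by
    filter_upwards [h1] with t ht using ht.deriv
  have e2 : deriv (deriv φ) 0 = c := (h3.congr_of_eventuallyEq e1).deriv
  have hmin : IsLocalMin φ 0 := isLocalMin_of_deriv_deriv_pos (by rw [e2]; exact hcon)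
    (by rw [e1.eq_of_nhds, h2, hb]) h1.self_of_nhds.continuousAt
  have hconst : φ =ᶠ[𝓝 0] fun _ => φ 0 := by
    filter_upwards [hm, hmin] with t h1 h2 using le_antisymm h1 h2
  have e3 : φ' =ᶠ[𝓝 0] fun _ => 0 := by
    filter_upwards [h1, hconst.eventuallyEq_nhds] with t ht he
    exact ht.unique ((hasDerivAt_const t (φ 0)).congr_of_eventuallyEq he)
  have := h3.unique ((hasDerivAt_const (0:ℝ) (0:ℝ)).congr_of_eventuallyEq e3)
  linarith

lemma two_le_smooth : (2 : WithTop ℕ∞) ≤ ((⊤ : ℕ∞) : WithTop ℕ∞) := by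
  exact WithTop.coe_le_coe.2 (le_top : (2 : ℕ∞) ≤ ⊤)

/-- Directional derivative. -/
def Dv (v : E3) (φ : E3 → ℝ) : E3 → ℝ := fun x => fderiv ℝ φ x v

def Sm (φ : E3 → ℝ) : Prop := ContDiffOn ℝ (⊤ : ℕ∞) φ (ball (0 : E3) 10)

lemma Sm.at {φ : E3 → ℝ} (h : Sm φ) {x : E3} (hx : x ∈ ball (0 : E3) 10) :
    ContDiffAt ℝ (⊤ : ℕ∞) φ x := h.contDiffAt (isOpen_ball.mem_nhds hx)

lemma Sm.diff {φ : E3 → ℝ} (h : Sm φ) {x : E3} (hx : x ∈ ball (0 : E3) 10) :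
    DifferentiableAt ℝ φ x := (h.at hx).differentiableAt (by simp)

lemma Sm.Dv {φ : E3 → ℝ} (h : Sm φ) (v : E3) : Sm (Dv v φ) := by
  have : ContDiffOn ℝ (⊤ : ℕ∞) (fderiv ℝ φ) (ball (0 : E3) 10) :=
    h.fderiv_of_isOpen isOpen_ball (by simp)
  exact this.clm_apply contDiffOn_const

lemma Dv_congr {φ ψ : E3 → ℝ} (h : ∀ x ∈ ball (0 : E3) 10, φ x = ψ x) (v : E3) :
    ∀ x ∈ ball (0 : E3) 10, Dv v φ x = Dv v ψ x := by
  intro x hx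
  have : φ =ᶠ[𝓝 x] ψ := by
    filter_upwards [isOpen_ball.mem_nhds hx] with y hy using h y hy
  unfold Dv
  rw [this.fderiv_eq]

lemma Sm.comm {φ : E3 → ℝ} (h : Sm φ) (v w : E3) :
    ∀ x ∈ ball (0 : E3) 10, _root_.Dv v (_root_.Dv w φ) x = _root_.Dv w (_root_.Dv v φ) x := by
  intro x hx
  have hd : DifferentiableAt ℝ (fderiv ℝ φ) x :=
    ((h.at hx).fderiv_right (m := 1) (by rw [one_add_one_eq_two]; exact two_le_smooth)).differentiableAt (by simp)
  have key : ∀ v w : E3, _root_.Dv v (_root_.Dv w φ) x = fderiv ℝ (fderiv ℝ φ) x v w := by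
    intro v w
    unfold _root_.Dv
    rw [fderiv_clm_apply hd (differentiableAt_const w)]
    simp
  rw [key, key]
  have := (h.at hx).isSymmSndFDerivAt (by simpa using two_le_smooth)
  exact this v w

lemma Sm.J2_line {φ : E3 → ℝ} (h : Sm φ) {x : E3} (hx : x ∈ ball (0 : E3) 10) (v : E3) :
    J2 (fun t => φ (x + t • v)) (φ x) (_root_.Dv v φ x) (_root_.Dv v (_root_.Dv v φ) x) := by
  have hcont : Continuous fun t : ℝ => x + t • v := by fun_prop
  have hnear : ∀ᶠ t in 𝓝 (0:ℝ), x + t • v ∈ ball (0 : E3) 10 :=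
    hcont.continuousAt.eventually (isOpen_ball.mem_nhds (by simpa using hx))
  have hl : ∀ t : ℝ, HasDerivAt (fun t : ℝ => x + t • v) v t := by
    intro t
    simpa using ((hasDerivAt_id t).smul_const v).const_add x
  have gen : ∀ ψ : E3 → ℝ, Sm ψ → ∀ t : ℝ, x + t • v ∈ ball (0 : E3) 10 →
      HasDerivAt (fun t => ψ (x + t • v)) (_root_.Dv v ψ (x + t • v)) t := by
    intro ψ hψ t ht
    exact (hψ.diff ht).hasFDerivAt.comp_hasDerivAt t (hl t)
  refine ⟨by simp, fun t => _root_.Dv v φ (x + t • v), ?_, by simp, ?_⟩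
  · filter_upwards [hnear] with t ht using gen φ h t ht
  · have := gen _ (h.Dv v) 0 (by simpa using hx)
    simpa using this

lemma qform (g1 g2 g3 F a b c F1 G1 : ℝ) (h1 : 0 < g1) (h2 : 0 < g2) (h3 : 0 < g3) (hF : 0 < F)
    (eF : 4 * F = 2 * (g1 * g2 + g1 * g3 + g2 * g3) - (g1 ^ 2 + g2 ^ 2 + g3 ^ 2))
    (eF1 : F1 = g1 * a + g2 * b + g3 * c)
    (eG1 : G1 = g1 * g2 * (a + b) + g1 * g3 * (a + c) + g2 * g3 * (b + c)) :
    -(F1 ^ 2 / F * (g1 * (g2 + g3))) ≤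
      2 * g1 * (g2 * b * (b - a) + g3 * c * (c - a) - (g2 + g3 - g1) * (b * c))
        + 2 * g1 * F1 * (a + b + c) - g1 * G1 ^ 2 / (g1 * g2 * g3) := by
  set X := 2 * g1 * (g2 * b * (b - a) + g3 * c * (c - a) - (g2 + g3 - g1) * (b * c))
        + 2 * g1 * F1 * (a + b + c) with hX
  have key : X - g1 * G1 ^ 2 / (g1 * g2 * g3) + F1 ^ 2 / F * (g1 * (g2 + g3)) =
      (g2 ^ 2 * (2 * F * b - F1 * ((g1 + g3 - g2) / 2)) ^ 2
        + g3 ^ 2 * (2 * F * c - F1 * ((g1 + g2 - g3) / 2)) ^ 2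
        + F * (g2 * g3 * (b + c)) ^ 2) / (F * (g2 * g3)) := by
    have e : F = (2 * (g1 * g2 + g1 * g3 + g2 * g3) - (g1 ^ 2 + g2 ^ 2 + g3 ^ 2)) / 4 := by
      linarith
    have e1 : g1 * G1 ^ 2 / (g1 * g2 * g3) = G1 ^ 2 / (g2 * g3) := by field_simp
    rw [e1, eq_div_iff (by positivity)]
    have e2 : (X - G1 ^ 2 / (g2 * g3) + F1 ^ 2 / F * (g1 * (g2 + g3))) * (F * (g2 * g3)) =
        X * (F * (g2 * g3)) - G1 ^ 2 * F + F1 ^ 2 * (g1 * (g2 + g3)) * (g2 * g3) := by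
      field_simp
    rw [e2, hX, eG1, eF1, e]
    ring
  have : 0 ≤ X - g1 * G1 ^ 2 / (g1 * g2 * g3) + F1 ^ 2 / F * (g1 * (g2 + g3)) := by
    rw [key]; positivity
  linarith

lemma main_alg (l F1 F2 R fp G1 G2 : Fin 3 → ℝ) (T : Fin 3 → Fin 3 → Fin 3 → ℝ)
    (Q : Fin 3 → Fin 3 → ℝ) (F s : ℝ)
    (hT1 : ∀ i j k, T i j k = T j i k) (hT2 : ∀ i j k, T i j k = T i k j)
    (hQ : ∀ i j, Q i j = Q j i)
    (hs : s = l 0 + l 1 + l 2)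
    (hF : F = l 0 * l 1 + l 0 * l 2 + l 1 * l 2) (hF0 : 0 < F)
    (hg : ∀ i, 0 < s - l i)
    (E1 : ∀ i, (s - l 0) * T 0 0 i + (s - l 1) * T 1 1 i + (s - l 2) * T 2 2 i = F1 i)
    (E2 : ∀ k, (s - l 0) * Q 0 k + (s - l 1) * Q 1 k + (s - l 2) * Q 2 k
      + 2 * (T 0 0 k * T 1 1 k + T 0 0 k * T 2 2 k + T 1 1 k * T 2 2 k
        - T 0 1 k ^ 2 - T 0 2 k ^ 2 - T 1 2 k ^ 2) = F2 k)
    (hF2 : ∀ k, F2 k = R k + (fp 0 * T 0 k k + fp 1 * T 1 k k + fp 2 * T 2 k k))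
    (hG1 : ∀ i, G1 i = F1 i * s + F * (T 0 0 i + T 1 1 i + T 2 2 i)
      - (l 1 * l 2 * T 0 0 i + l 0 * l 2 * T 1 1 i + l 0 * l 1 * T 2 2 i))
    (hG2 : ∀ i, G2 i = F2 i * s + 2 * F1 i * (T 0 0 i + T 1 1 i + T 2 2 i)
      + F * (Q 0 i + Q 1 i + Q 2 i)
      - (l 1 * l 2 * Q 0 i + l 0 * l 2 * Q 1 i + l 0 * l 1 * Q 2 i
        + 2 * (l 2 * (T 0 0 i * T 1 1 i) + l 1 * (T 0 0 i * T 2 2 i) + l 0 * (T 1 1 i * T 2 2 i))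
        - 2 * (l 2 * T 0 1 i ^ 2 + l 1 * T 0 2 i ^ 2 + l 0 * T 1 2 i ^ 2))) :
    ((s - l 0) * (s + l 0) * R 0 + (s - l 1) * (s + l 1) * R 1 + (s - l 2) * (s + l 2) * R 2)
      - (F1 0 ^ 2 / F * ((s - l 0) * (s + l 0)) + F1 1 ^ 2 / F * ((s - l 1) * (s + l 1))
        + F1 2 ^ 2 / F * ((s - l 2) * (s + l 2)))
    ≤ ((s - l 0) * G2 0 + (s - l 1) * G2 1 + (s - l 2) * G2 2)
      - ((s - l 0) * G1 0 ^ 2 / ((s - l 0) * (s - l 1) * (s - l 2))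
        + (s - l 1) * G1 1 ^ 2 / ((s - l 0) * (s - l 1) * (s - l 2))
        + (s - l 2) * G1 2 ^ 2 / ((s - l 0) * (s - l 1) * (s - l 2)))
      - (fp 0 * G1 0 + fp 1 * G1 1 + fp 2 * G1 2) := by
  have t1 : T 0 1 0 = T 0 0 1 := hT2 _ _ _
  have t2 : T 1 0 0 = T 0 0 1 := (hT1 _ _ _).trans t1
  have t3 : T 0 2 0 = T 0 0 2 := hT2 _ _ _
  have t4 : T 2 0 0 = T 0 0 2 := (hT1 _ _ _).trans t3
  have t5 : T 1 0 1 = T 1 1 0 := hT2 _ _ _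
  have t6 : T 0 1 1 = T 1 1 0 := (hT1 _ _ _).trans t5
  have t7 : T 1 2 1 = T 1 1 2 := hT2 _ _ _
  have t8 : T 2 1 1 = T 1 1 2 := (hT1 _ _ _).trans t7
  have t9 : T 2 0 2 = T 2 2 0 := hT2 _ _ _
  have t10 : T 0 2 2 = T 2 2 0 := (hT1 _ _ _).trans t9
  have t11 : T 2 1 2 = T 2 2 1 := hT2 _ _ _
  have t12 : T 1 2 2 = T 2 2 1 := (hT1 _ _ _).trans t11
  have t13 : T 0 2 1 = T 0 1 2 := hT2 _ _ _
  have t14 : T 1 2 0 = T 0 1 2 := (hT2 _ _ _).trans (hT1 _ _ _)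
  have eQ1 : Q 1 0 = Q 0 1 := hQ _ _
  have eQ2 : Q 2 0 = Q 0 2 := hQ _ _
  have eQ3 : Q 2 1 = Q 1 2 := hQ _ _
  have a0 := E1 0
  have a1 := E1 1
  have a2 := E1 2
  have b0 := E2 0
  have b1 := E2 1
  have b2 := E2 2
  have c0 := hF2 0
  have c1 := hF2 1
  have c2 := hF2 2
  have d0 := hG1 0
  have d1 := hG1 1
  have d2 := hG1 2
  have f0 := hG2 0
  have f1 := hG2 1
  have f2 := hG2 2
  have g0 := hg 0
  have g1 := hg 1
  have g2 := hg 2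
  simp only [t1, t2, t3, t4, t5, t6, t7, t8, t9, t10, t11, t12, t13, t14, eQ1, eQ2, eQ3] at *
  have eF : 4 * F = 2 * ((s - l 0) * (s - l 1) + (s - l 0) * (s - l 2) + (s - l 1) * (s - l 2))
      - ((s - l 0) ^ 2 + (s - l 1) ^ 2 + (s - l 2) ^ 2) := by rw [hF, hs]; ring
  have q0 := qform (s - l 0) (s - l 1) (s - l 2) F (T 0 0 0) (T 1 1 0) (T 2 2 0) (F1 0) (G1 0)
    g0 g1 g2 hF0 eF (by rw [← a0]) (by rw [d0, ← a0, hF, hs]; ring)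
  have q1 := qform (s - l 1) (s - l 0) (s - l 2) F (T 1 1 1) (T 0 0 1) (T 2 2 1) (F1 1) (G1 1)
    g1 g0 g2 hF0 (by rw [eF]; ring) (by rw [← a1]; ring) (by rw [d1, ← a1, hF, hs]; ring)
  have q2 := qform (s - l 2) (s - l 0) (s - l 1) F (T 2 2 2) (T 0 0 2) (T 1 1 2) (F1 2) (G1 2)
    g2 g0 g1 hF0 (by rw [eF]; ring) (by rw [← a2]; ring) (by rw [d2, ← a2, hF, hs]; ring)
  rw [show (s - l 1) * (s - l 0) * (s - l 2) = (s - l 0) * (s - l 1) * (s - l 2) by ring,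
    show (s - l 0) + (s - l 2) = s + l 1 by rw [hs]; ring] at q1
  rw [show (s - l 2) * (s - l 0) * (s - l 1) = (s - l 0) * (s - l 1) * (s - l 2) by ring,
    show (s - l 0) + (s - l 1) = s + l 2 by rw [hs]; ring] at q2
  rw [show (s - l 1) + (s - l 2) = s + l 0 by rw [hs]; ring] at q0
  have w : 0 ≤ 8 * F * T 0 1 2 ^ 2 := by positivity
  -- the gradient term
  have hp0 : (s - l 0) * (s + l 0) * T 0 0 0 + (s - l 1) * (s + l 1) * T 1 1 0
      + (s - l 2) * (s + l 2) * T 2 2 0 = G1 0 := by rw [d0, ← a0, hF, hs]; ring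
  have hp1 : (s - l 0) * (s + l 0) * T 0 0 1 + (s - l 1) * (s + l 1) * T 1 1 1
      + (s - l 2) * (s + l 2) * T 2 2 1 = G1 1 := by rw [d1, ← a1, hF, hs]; ring
  have hp2 : (s - l 0) * (s + l 0) * T 0 0 2 + (s - l 1) * (s + l 1) * T 1 1 2
      + (s - l 2) * (s + l 2) * T 2 2 2 = G1 2 := by rw [d2, ← a2, hF, hs]; ring
  have hR : (s - l 0) * (s + l 0) * F2 0 + (s - l 1) * (s + l 1) * F2 1
      + (s - l 2) * (s + l 2) * F2 2 =
      ((s - l 0) * (s + l 0) * R 0 + (s - l 1) * (s + l 1) * R 1 + (s - l 2) * (s + l 2) * R 2)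
      + (fp 0 * G1 0 + fp 1 * G1 1 + fp 2 * G1 2) := by
    rw [c0, c1, c2, ← hp0, ← hp1, ← hp2]; ring
  have hL : (s - l 0) * G2 0 + (s - l 1) * G2 1 + (s - l 2) * G2 2 =
      (s - l 0) * (s + l 0) * F2 0 + (s - l 1) * (s + l 1) * F2 1
      + (s - l 2) * (s + l 2) * F2 2
      + (2 * (s - l 0) * ((s - l 1) * T 1 1 0 * (T 1 1 0 - T 0 0 0)
          + (s - l 2) * T 2 2 0 * (T 2 2 0 - T 0 0 0)
          - ((s - l 1) + (s - l 2) - (s - l 0)) * (T 1 1 0 * T 2 2 0))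
        + 2 * (s - l 0) * F1 0 * (T 0 0 0 + T 1 1 0 + T 2 2 0))
      + (2 * (s - l 1) * ((s - l 0) * T 0 0 1 * (T 0 0 1 - T 1 1 1)
          + (s - l 2) * T 2 2 1 * (T 2 2 1 - T 1 1 1)
          - ((s - l 0) + (s - l 2) - (s - l 1)) * (T 0 0 1 * T 2 2 1))
        + 2 * (s - l 1) * F1 1 * (T 1 1 1 + T 0 0 1 + T 2 2 1))
      + (2 * (s - l 2) * ((s - l 0) * T 0 0 2 * (T 0 0 2 - T 2 2 2)
          + (s - l 1) * T 1 1 2 * (T 1 1 2 - T 2 2 2)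
          - ((s - l 0) + (s - l 1) - (s - l 2)) * (T 0 0 2 * T 1 1 2))
        + 2 * (s - l 2) * F1 2 * (T 2 2 2 + T 0 0 2 + T 1 1 2))
      + 8 * F * T 0 1 2 ^ 2 := by
    rw [f0, f1, f2, ← b0, ← b1, ← b2, hF, hs]; ring
  rw [show (s - l 0) + (s - l 2) - (s - l 1) = s + l 1 - (s - l 1) by rw [hs]; ring,
    show (s - l 1) + (s - l 2) - (s - l 0) = s + l 0 - (s - l 0) by rw [hs]; ring,
    show (s - l 0) + (s - l 1) - (s - l 2) = s + l 2 - (s - l 2) by rw [hs]; ring] at hL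
  linarith

lemma idx_bound (K g l F G F1 R s fx fu fp p : ℝ) (hK : 1 ≤ K) (hg : 0 < g) (hF : 1 / K ≤ F)
    (hG : g * (l ^ 2 + F) = G) (hs : 0 ≤ s + l) (hs' : s + l ≤ 2 * s)
    (hF1 : F1 = fx + fu * p + fp * l) (hfx : |fx| ≤ K) (hfu : |fu| ≤ K) (hfp : |fp| ≤ K)
    (hp : |p| ≤ K) (hR : |R| ≤ K * (1 + K + |l|) ^ 2 + K * |l|) :
    -(34 * K ^ 6 * s * G) ≤ g * (s + l) * R - F1 ^ 2 / F * (g * (s + l)) := by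
  have hK0 : 0 < K := by linarith
  have hFK : 1 ≤ K * F := by
    rw [div_le_iff₀ hK0] at hF; linarith
  have hF0 : 0 < F := lt_of_lt_of_le (by positivity) hF
  have hG0 : 0 < G := by rw [← hG]; positivity
  have hs0 : 0 ≤ s := by linarith
  have h1 : g * (1 + l ^ 2) ≤ K * G := by
    rw [← hG]
    nlinarith [mul_nonneg hg.le (sq_nonneg l)]
  have hl := abs_nonneg l
  have hl2 : |l| ^ 2 = l ^ 2 := sq_abs l
  have hlq : (1 + |l|) ^ 2 ≤ 2 * (1 + l ^ 2) := by nlinarith [sq_nonneg (1 - |l|)]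
  have hKl : 0 ≤ (K - 1) * |l| := mul_nonneg (by linarith) hl
  have hR' : |R| ≤ 9 * K ^ 3 * (1 + l ^ 2) := by
    have e1 : 1 + K + |l| ≤ 2 * K * (1 + |l|) := by nlinarith
    have e2 : (1 + K + |l|) ^ 2 ≤ (2 * K * (1 + |l|)) ^ 2 := by gcongr
    have e3 : K * (1 + K + |l|) ^ 2 ≤ 8 * K ^ 3 * (1 + l ^ 2) := by
      calc K * (1 + K + |l|) ^ 2 ≤ K * (2 * K * (1 + |l|)) ^ 2 := by gcongr
        _ = 4 * K ^ 3 * (1 + |l|) ^ 2 := by ring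
        _ ≤ 4 * K ^ 3 * (2 * (1 + l ^ 2)) := by gcongr
        _ = _ := by ring
    have e4 : K ≤ K ^ 3 := le_self_pow₀ hK (by norm_num)
    have e5 : |l| ≤ 1 + l ^ 2 := by nlinarith [sq_nonneg (1 - |l|)]
    have e6 : K * |l| ≤ K ^ 3 * (1 + l ^ 2) := by gcongr
    linarith
  have hF1' : F1 ^ 2 ≤ 8 * K ^ 4 * (1 + l ^ 2) := by
    have e1 : |F1| ≤ 2 * K ^ 2 * (1 + |l|) := by
      have : |F1| ≤ |fx| + |fu| * |p| + |fp| * |l| := by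
        rw [hF1, ← abs_mul, ← abs_mul]
        exact (abs_add_le _ _).trans (by gcongr; exact abs_add_le _ _)
      have e2 : |fu| * |p| ≤ K * K := by gcongr
      have e3 : |fp| * |l| ≤ K * |l| := by gcongr
      have e4 : K ≤ K ^ 2 := le_self_pow₀ hK (by norm_num)
      have e5 : K * |l| ≤ K ^ 2 * |l| := by gcongr
      have e6 : 0 ≤ K ^ 2 * |l| := by positivity
      nlinarith
    calc F1 ^ 2 = |F1| ^ 2 := (sq_abs _).symm
      _ ≤ (2 * K ^ 2 * (1 + |l|)) ^ 2 := by gcongr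
      _ = 4 * K ^ 4 * (1 + |l|) ^ 2 := by ring
      _ ≤ 4 * K ^ 4 * (2 * (1 + l ^ 2)) := by gcongr
      _ = _ := by ring
  have hinv : 1 / F ≤ K := by
    rw [div_le_iff₀ hF0]; exact hFK
  have b1 : F1 ^ 2 / F * (g * (s + l)) ≤ 16 * K ^ 6 * s * G := by
    calc F1 ^ 2 / F * (g * (s + l)) = F1 ^ 2 * (1 / F) * g * (s + l) := by ring
      _ ≤ (8 * K ^ 4 * (1 + l ^ 2)) * K * g * (2 * s) := by gcongr
      _ = 16 * K ^ 5 * s * (g * (1 + l ^ 2)) := by ring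
      _ ≤ 16 * K ^ 5 * s * (K * G) := by gcongr
      _ = _ := by ring
  have b2 : |g * (s + l) * R| ≤ 18 * K ^ 6 * s * G := by
    rw [abs_mul, abs_of_nonneg (by positivity : 0 ≤ g * (s + l))]
    calc g * (s + l) * |R| ≤ g * (2 * s) * (9 * K ^ 3 * (1 + l ^ 2)) := by gcongr
      _ = 18 * K ^ 3 * s * (g * (1 + l ^ 2)) := by ring
      _ ≤ 18 * K ^ 3 * s * (K * G) := by gcongr
      _ = 18 * K ^ 4 * s * G := by ring
      _ ≤ 18 * K ^ 6 * s * G := by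
        have : K ^ 4 ≤ K ^ 6 := pow_le_pow_right₀ hK (by norm_num)
        gcongr
  have := neg_abs_le (g * (s + l) * R)
  linarith

set_option maxHeartbeats 1000000 in
lemma final_alg (K M r G : ℝ) (l F1 F2 R fp fx x p G1 G2 : Fin 3 → ℝ) (fu : ℝ)
    (T : Fin 3 → Fin 3 → Fin 3 → ℝ)
    (Q : Fin 3 → Fin 3 → ℝ) (F s : ℝ) (hK : 1 ≤ K) (hM : 1 ≤ M) (hsM : s ≤ M)
    (hr : 0 < r) (hr' : r ≤ 25)
    (hT1 : ∀ i j k, T i j k = T j i k) (hT2 : ∀ i j k, T i j k = T i k j)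
    (hQ : ∀ i j, Q i j = Q j i)
    (hs : s = l 0 + l 1 + l 2) (hs0 : 0 < s)
    (hF : F = l 0 * l 1 + l 0 * l 2 + l 1 * l 2) (hFK : 1 / K ≤ F) (hFK' : F ≤ K)
    (hG : G = F * s - l 0 * l 1 * l 2)
    (E1 : ∀ i, (s - l 0) * T 0 0 i + (s - l 1) * T 1 1 i + (s - l 2) * T 2 2 i = F1 i)
    (E2 : ∀ k, (s - l 0) * Q 0 k + (s - l 1) * Q 1 k + (s - l 2) * Q 2 k
      + 2 * (T 0 0 k * T 1 1 k + T 0 0 k * T 2 2 k + T 1 1 k * T 2 2 k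
        - T 0 1 k ^ 2 - T 0 2 k ^ 2 - T 1 2 k ^ 2) = F2 k)
    (hF1 : ∀ i, F1 i = fx i + fu * p i + fp i * l i)
    (hF2 : ∀ k, F2 k = R k + (fp 0 * T 0 k k + fp 1 * T 1 k k + fp 2 * T 2 k k))
    (hG1 : ∀ i, G1 i = F1 i * s + F * (T 0 0 i + T 1 1 i + T 2 2 i)
      - (l 1 * l 2 * T 0 0 i + l 0 * l 2 * T 1 1 i + l 0 * l 1 * T 2 2 i))
    (hG2 : ∀ i, G2 i = F2 i * s + 2 * F1 i * (T 0 0 i + T 1 1 i + T 2 2 i)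
      + F * (Q 0 i + Q 1 i + Q 2 i)
      - (l 1 * l 2 * Q 0 i + l 0 * l 2 * Q 1 i + l 0 * l 1 * Q 2 i
        + 2 * (l 2 * (T 0 0 i * T 1 1 i) + l 1 * (T 0 0 i * T 2 2 i) + l 0 * (T 1 1 i * T 2 2 i))
        - 2 * (l 2 * T 0 1 i ^ 2 + l 1 * T 0 2 i ^ 2 + l 0 * T 1 2 i ^ 2)))
    (hfx : ∀ i, |fx i| ≤ K) (hfu : |fu| ≤ K) (hfp : ∀ i, |fp i| ≤ K)
    (hp : ∀ i, |p i| ≤ K) (hx : ∀ i, |x i| ≤ 5)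
    (hR : ∀ i, |R i| ≤ K * (1 + K + |l i|) ^ 2 + K * |l i|)
    (M1 : ∀ i, 2 * (-2 * x i / r) + G1 i / G + p i * l i = 0)
    (M2 : ∀ i, 2 * (-2 / r - (-2 * x i / r) ^ 2) + (G2 i / G - (G1 i / G) ^ 2)
      + (l i ^ 2 + (p 0 * T 0 i i + p 1 * T 1 i i + p 2 * T 2 i i)) ≤ 0) :
    r ^ 2 * G ≤ 24000 * K ^ 6 * M := by
  have hK0 : 0 < K := by linarith
  have hF0 : 0 < F := lt_of_lt_of_le (by positivity) hFK
  have p01 : (s - l 0) * (s - l 1) = l 2 ^ 2 + F := by rw [hF, hs]; ring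
  have p02 : (s - l 0) * (s - l 2) = l 1 ^ 2 + F := by rw [hF, hs]; ring
  have p12 : (s - l 1) * (s - l 2) = l 0 ^ 2 + F := by rw [hF, hs]; ring
  have q01 : 0 < (s - l 0) * (s - l 1) := by rw [p01]; positivity
  have q02 : 0 < (s - l 0) * (s - l 2) := by rw [p02]; positivity
  have g0 : 0 < s - l 0 := by
    by_contra h
    push Not at h
    have h1 : s - l 1 < 0 := by by_contra h'; push Not at h'; nlinarith
    have h2 : s - l 2 < 0 := by by_contra h'; push Not at h'; nlinarith
    linarith
  have g1 : 0 < s - l 1 := pos_of_mul_pos_right q01 g0.le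
  have g2 : 0 < s - l 2 := pos_of_mul_pos_right q02 g0.le
  have hg : ∀ i, 0 < s - l i := by
    intro i; fin_cases i
    · exact g0
    · exact g1
    · exact g2
  have hGp : G = (s - l 0) * (s - l 1) * (s - l 2) := by rw [hG, hF, hs]; ring
  have hG0 : 0 < G := by rw [hGp]; positivity
  have main := main_alg l F1 F2 R fp G1 G2 T Q F s hT1 hT2 hQ hs hF hF0 hg E1 E2 hF2 hG1 hG2
  rw [← hGp] at main
  have i0 := idx_bound K (s - l 0) (l 0) F G (F1 0) (R 0) s (fx 0) fu (fp 0) (p 0) hK g0 hFK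
    (by rw [hGp, ← p12]; ring) (by linarith) (by linarith) (hF1 0) (hfx 0) hfu (hfp 0) (hp 0) (hR 0)
  have i1 := idx_bound K (s - l 1) (l 1) F G (F1 1) (R 1) s (fx 1) fu (fp 1) (p 1) hK g1 hFK
    (by rw [hGp, ← p02]; ring) (by linarith) (by linarith) (hF1 1) (hfx 1) hfu (hfp 1) (hp 1) (hR 1)
  have i2 := idx_bound K (s - l 2) (l 2) F G (F1 2) (R 2) s (fx 2) fu (fp 2) (p 2) hK g2 hFK
    (by rw [hGp, ← p01]; ring) (by linarith) (by linarith) (hF1 2) (hfx 2) hfu (hfp 2) (hp 2) (hR 2)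
  set Z := ((s - l 0) * G2 0 + (s - l 1) * G2 1 + (s - l 2) * G2 2)
      - ((s - l 0) * G1 0 ^ 2 / G + (s - l 1) * G1 1 ^ 2 / G + (s - l 2) * G1 2 ^ 2 / G)
      - (fp 0 * G1 0 + fp 1 * G1 1 + fp 2 * G1 2) with hZ
  have hZb : -(102 * K ^ 6 * s * G) ≤ Z := by linarith only [main, i0, i1, i2]
  have hZG : -(102 * K ^ 6 * s) ≤ Z / G := by
    rw [le_div_iff₀ hG0]; linarith only [hZb]
  have hZe : Z / G = (s - l 0) * (G2 0 / G - (G1 0 / G) ^ 2) + (s - l 1) * (G2 1 / G - (G1 1 / G) ^ 2)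
      + (s - l 2) * (G2 2 / G - (G1 2 / G) ^ 2)
      - (fp 0 * (G1 0 / G) + fp 1 * (G1 1 / G) + fp 2 * (G1 2 / G)) := by
    rw [hZ]; field_simp; ring
  have m0 := mul_nonpos_of_nonneg_of_nonpos g0.le (M2 0)
  have m1 := mul_nonpos_of_nonneg_of_nonpos g1.le (M2 1)
  have m2 := mul_nonpos_of_nonneg_of_nonpos g2.le (M2 2)
  have n0 : fp 0 * (2 * (-2 * x 0 / r) + G1 0 / G + p 0 * l 0) = 0 := by rw [M1 0, mul_zero]
  have n1 : fp 1 * (2 * (-2 * x 1 / r) + G1 1 / G + p 1 * l 1) = 0 := by rw [M1 1, mul_zero]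
  have n2 : fp 2 * (2 * (-2 * x 2 / r) + G1 2 / G + p 2 * l 2) = 0 := by rw [M1 2, mul_zero]
  -- linear third-order terms
  have t1 : T 0 1 0 = T 0 0 1 := hT2 _ _ _
  have t2 : T 1 0 0 = T 0 0 1 := (hT1 _ _ _).trans t1
  have t3 : T 0 2 0 = T 0 0 2 := hT2 _ _ _
  have t4 : T 2 0 0 = T 0 0 2 := (hT1 _ _ _).trans t3
  have t5 : T 1 0 1 = T 1 1 0 := hT2 _ _ _
  have t6 : T 0 1 1 = T 1 1 0 := (hT1 _ _ _).trans t5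
  have t7 : T 1 2 1 = T 1 1 2 := hT2 _ _ _
  have t8 : T 2 1 1 = T 1 1 2 := (hT1 _ _ _).trans t7
  have t9 : T 2 0 2 = T 2 2 0 := hT2 _ _ _
  have t10 : T 0 2 2 = T 2 2 0 := (hT1 _ _ _).trans t9
  have t11 : T 2 1 2 = T 2 2 1 := hT2 _ _ _
  have t12 : T 1 2 2 = T 2 2 1 := (hT1 _ _ _).trans t11
  simp only [t2, t4, t6, t8, t10, t12] at m0 m1 m2
  have k0 : p 0 * ((s - l 0) * T 0 0 0 + (s - l 1) * T 1 1 0 + (s - l 2) * T 2 2 0)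
      = p 0 * (fx 0 + fu * p 0 + fp 0 * l 0) := by rw [E1 0, hF1 0]
  have k1 : p 1 * ((s - l 0) * T 0 0 1 + (s - l 1) * T 1 1 1 + (s - l 2) * T 2 2 1)
      = p 1 * (fx 1 + fu * p 1 + fp 1 * l 1) := by rw [E1 1, hF1 1]
  have k2 : p 2 * ((s - l 0) * T 0 0 2 + (s - l 1) * T 1 1 2 + (s - l 2) * T 2 2 2)
      = p 2 * (fx 2 + fu * p 2 + fp 2 * l 2) := by rw [E1 2, hF1 2]
  have hsum : (s - l 0) * l 0 ^ 2 + (s - l 1) * l 1 ^ 2 + (s - l 2) * l 2 ^ 2 = 3 * G - 2 * F * s := by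
    rw [hG, hF, hs]; ring
  have pb : ∀ i, -(2 * K ^ 3) ≤ p i * (fx i + fu * p i) := by
    intro i
    have h1 : |p i * (fx i + fu * p i)| ≤ K * (K + K * K) := by
      rw [abs_mul]
      have : |fx i + fu * p i| ≤ K + K * K := by
        refine (abs_add_le _ _).trans ?_
        rw [abs_mul]
        have := hfx i; have := hp i
        gcongr
      have := hp i
      gcongr
    have h2 : K ^ 2 ≤ K ^ 3 := pow_le_pow_right₀ hK (by norm_num)
    have h3 := neg_abs_le (p i * (fx i + fu * p i))
    have h4 : K * (K + K * K) = K ^ 2 + K ^ 3 := by ring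
    linarith only [h1, h2, h3, h4]
  have xb : ∀ i, x i ^ 2 ≤ 25 := by
    intro i
    have h := abs_le.1 (hx i)
    nlinarith only [h.1, h.2]
  have fxb : ∀ i, -(5 * K) ≤ fp i * x i := by
    intro i
    have h1 : |fp i * x i| ≤ K * 5 := by
      rw [abs_mul]
      have := hfp i; have := hx i
      gcongr
    have h2 := neg_abs_le (fp i * x i)
    linarith only [h1, h2]
  -- combine
  have hA : Z / G + (3 * G - 2 * F * s)
      + (p 0 * (fx 0 + fu * p 0) + p 1 * (fx 1 + fu * p 1) + p 2 * (fx 2 + fu * p 2))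
      + 4 / r * (fp 0 * x 0 + fp 1 * x 1 + fp 2 * x 2)
      - 8 * s / r
      - 8 / r ^ 2 * ((s - l 0) * x 0 ^ 2 + (s - l 1) * x 1 ^ 2 + (s - l 2) * x 2 ^ 2) ≤ 0 := by
    have e4 : 8 * s / r = 4 * r⁻¹ * ((s - l 0) + (s - l 1) + (s - l 2)) := by rw [hs]; ring
    rw [e4, hZe, ← hsum]
    linear_combination m0 + m1 + m2 - n0 - n1 - n2 - k0 - k1 - k2
  have hx2 : (s - l 0) * x 0 ^ 2 + (s - l 1) * x 1 ^ 2 + (s - l 2) * x 2 ^ 2 ≤ 50 * s := by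
    have h0 := mul_le_mul_of_nonneg_left (xb 0) g0.le
    have h1 := mul_le_mul_of_nonneg_left (xb 1) g1.le
    have h2 := mul_le_mul_of_nonneg_left (xb 2) g2.le
    linarith only [h0, h1, h2, hs]
  have hB1 : 8 / r ^ 2 * ((s - l 0) * x 0 ^ 2 + (s - l 1) * x 1 ^ 2 + (s - l 2) * x 2 ^ 2)
      ≤ 8 / r ^ 2 * (50 * s) := by gcongr
  have hB2 : 4 / r * (-(15 * K)) ≤ 4 / r * (fp 0 * x 0 + fp 1 * x 1 + fp 2 * x 2) := by
    have h0 := fxb 0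
    have h1 := fxb 1
    have h2 := fxb 2
    gcongr
    linarith only [h0, h1, h2]
  have hFs : F * s ≤ K * s := by gcongr
  have hC : 3 * G ≤ 102 * K ^ 6 * s + 2 * (K * s) + 6 * K ^ 3 + 4 / r * (15 * K) + 8 * s / r
      + 8 / r ^ 2 * (50 * s) := by
    have h0 := pb 0
    have h1 := pb 1
    have h2 := pb 2
    linarith only [h0, h1, h2, hA, hB1, hB2, hFs, hZG]
  have hD : r ^ 2 * (3 * G) ≤ r ^ 2 * (102 * K ^ 6 * s + 2 * (K * s) + 6 * K ^ 3)
      + r * (60 * K + 8 * s) + 400 * s := by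
    have := mul_le_mul_of_nonneg_left hC (by positivity : 0 ≤ r ^ 2)
    refine this.trans (le_of_eq ?_)
    field_simp
    ring
  have hr2 : r ^ 2 ≤ 625 := by nlinarith only [hr, hr']
  have K1 : K ≤ K ^ 6 := le_self_pow₀ hK (by norm_num)
  have K3 : K ^ 3 ≤ K ^ 6 := pow_le_pow_right₀ hK (by norm_num)
  have K6 : 1 ≤ K ^ 6 := one_le_pow₀ hK
  have b1 : 102 * K ^ 6 * s + 2 * (K * s) + 6 * K ^ 3 ≤ 110 * (K ^ 6 * M) := by
    have h1 : K ^ 6 * s ≤ K ^ 6 * M := by gcongr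
    have h2 : K * s ≤ K ^ 6 * M := by gcongr
    have h3 : K ^ 3 * 1 ≤ K ^ 6 * M := by gcongr
    linarith only [h1, h2, h3]
  have hsK : s ≤ K ^ 6 * M := by nlinarith only [hsM, K6, hM]
  have b2 : 60 * K + 8 * s ≤ 68 * (K ^ 6 * M) := by
    have h1 : K * 1 ≤ K ^ 6 * M := by gcongr
    linarith only [h1, hsK]
  have hX : 0 < K ^ 6 * M := by positivity
  have c1 : r ^ 2 * (102 * K ^ 6 * s + 2 * (K * s) + 6 * K ^ 3) ≤ 625 * (110 * (K ^ 6 * M)) := by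
    gcongr
  have c2 : r * (60 * K + 8 * s) ≤ 25 * (68 * (K ^ 6 * M)) := by
    gcongr
  linarith only [hD, c1, c2, hsK, hX]

lemma Sm.line_deriv {ψ : E3 → ℝ} (h : Sm ψ) (x v : E3) (t : ℝ)
    (ht : x + t • v ∈ ball (0 : E3) 10) :
    HasDerivAt (fun t : ℝ => ψ (x + t • v)) (_root_.Dv v ψ (x + t • v)) t := by
  have hl : HasDerivAt (fun t : ℝ => x + t • v) v t := by
    simpa using ((hasDerivAt_id t).smul_const v).const_add x
  exact (h.diff ht).hasFDerivAt.comp_hasDerivAt t hl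

lemma line_near {x : E3} (hx : x ∈ ball (0 : E3) 10) (v : E3) :
    ∀ᶠ t in 𝓝 (0:ℝ), x + t • v ∈ ball (0 : E3) 10 := by
  have hcont : Continuous fun t : ℝ => x + t • v := by fun_prop
  exact hcont.continuousAt.eventually (isOpen_ball.mem_nhds (by simpa using hx))

lemma J2_comp {W : Type*} [NormedAddCommGroup W] [NormedSpace ℝ W] {f : W → ℝ}
    (hf : ContDiff ℝ 2 f) {γ γ' : ℝ → W} {γ'' : W}
    (h1 : ∀ᶠ t in 𝓝 (0:ℝ), HasDerivAt γ (γ' t) t) (h2 : HasDerivAt γ' γ'' 0) :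
    J2 (fun t => f (γ t)) (f (γ 0)) (fderiv ℝ f (γ 0) (γ' 0))
      (fderiv ℝ (fderiv ℝ f) (γ 0) (γ' 0) (γ' 0) + fderiv ℝ f (γ 0) γ'') := by
  have hd : Differentiable ℝ f := hf.differentiable (by norm_num)
  have hd2 : Differentiable ℝ (fderiv ℝ f) :=
    (hf.fderiv_right (m := 1) (by norm_num)).differentiable (by norm_num)
  refine ⟨rfl, fun t => fderiv ℝ f (γ t) (γ' t), ?_, rfl, ?_⟩
  · filter_upwards [h1] with t ht
    exact (hd (γ t)).hasFDerivAt.comp_hasDerivAt t ht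
  · have h3 : HasDerivAt (fun t => fderiv ℝ f (γ t)) (fderiv ℝ (fderiv ℝ f) (γ 0) (γ' 0)) 0 :=
      (hd2 (γ 0)).hasFDerivAt.comp_hasDerivAt 0 h1.self_of_nhds
    exact h3.clm_apply h2

lemma Dv_expand (v : E3) (φ : E3 → ℝ) (x : E3) :
    Dv v φ x = ∑ a, v a * pd a φ x := by
  have hv : v = ∑ a, v a • EuclideanSpace.single a (1:ℝ) := by
    have := (EuclideanSpace.basisFun (Fin 3) ℝ).sum_repr v
    simpa using this.symm
  unfold Dv pd
  conv_lhs => rw [hv]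
  simp [map_sum]

lemma pd_eq (i : Fin 3) (φ : E3 → ℝ) : pd i φ = Dv (EuclideanSpace.single i 1) φ := rfl

lemma Dv2_expand {u : E3 → ℝ} (hu : Sm u) (v w : E3) {x : E3} (hx : x ∈ ball (0 : E3) 10) :
    Dv v (Dv w u) x = ∑ a, ∑ b, v a * hess u x a b * w b := by
  have e : Dv w u = fun y => ∑ b, w b * pd b u y := funext fun y => Dv_expand w u y
  rw [Dv_expand, e]
  refine Finset.sum_congr rfl fun a _ => ?_
  have hdiff : ∀ b, DifferentiableAt ℝ (pd b u) x := fun b => (hu.Dv _).diff hx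
  have : pd a (fun y => ∑ b, w b * pd b u y) x = ∑ b, w b * pd a (pd b u) x := by
    change fderiv ℝ (fun y => ∑ b, w b * pd b u y) x (EuclideanSpace.single a 1)
      = ∑ b, w b * fderiv ℝ (pd b u) x (EuclideanSpace.single a 1)
    rw [fderiv_fun_sum fun b _ => ((hdiff b).const_mul (w b))]
    simp only [_root_.sum_apply]
    refine Finset.sum_congr rfl fun b _ => ?_
    rw [fderiv_const_mul (hdiff b) (w b)]
    simp
  rw [this, Finset.mul_sum]
  refine Finset.sum_congr rfl fun b _ => ?_
  simp only [hess, Matrix.of_apply]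
  ring

lemma hess_symm {u : E3 → ℝ} (hu : Sm u) {x : E3} (hx : x ∈ ball (0 : E3) 10) :
    (hess u x).IsHermitian := by
  ext i j
  simp only [Matrix.conjTranspose_apply, hess, Matrix.of_apply, star_trivial]
  exact hu.comm _ _ x hx

/-- Invariants of the Hessian in an orthonormal frame. -/
lemma frame_inv {u : E3 → ℝ} (hu : Sm u) (e : OrthonormalBasis (Fin 3) ℝ E3) {x : E3}
    (hx : x ∈ ball (0 : E3) 10) :
    lap u x = Dv (e 0) (Dv (e 0) u) x + Dv (e 1) (Dv (e 1) u) x + Dv (e 2) (Dv (e 2) u) x ∧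
    sigma2 (hess u x) = Dv (e 0) (Dv (e 0) u) x * Dv (e 1) (Dv (e 1) u) x
      + Dv (e 0) (Dv (e 0) u) x * Dv (e 2) (Dv (e 2) u) x
      + Dv (e 1) (Dv (e 1) u) x * Dv (e 2) (Dv (e 2) u) x
      - Dv (e 0) (Dv (e 1) u) x * Dv (e 0) (Dv (e 1) u) x
      - Dv (e 0) (Dv (e 2) u) x * Dv (e 0) (Dv (e 2) u) x
      - Dv (e 1) (Dv (e 2) u) x * Dv (e 1) (Dv (e 2) u) x ∧
    (hess u x).det = Dv (e 0) (Dv (e 0) u) x * Dv (e 1) (Dv (e 1) u) x * Dv (e 2) (Dv (e 2) u) x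
      - Dv (e 0) (Dv (e 0) u) x * (Dv (e 1) (Dv (e 2) u) x * Dv (e 1) (Dv (e 2) u) x)
      - Dv (e 1) (Dv (e 1) u) x * (Dv (e 0) (Dv (e 2) u) x * Dv (e 0) (Dv (e 2) u) x)
      - Dv (e 2) (Dv (e 2) u) x * (Dv (e 0) (Dv (e 1) u) x * Dv (e 0) (Dv (e 1) u) x)
      + 2 * (Dv (e 0) (Dv (e 1) u) x * Dv (e 0) (Dv (e 2) u) x * Dv (e 1) (Dv (e 2) u) x) := by
  set O : Matrix (Fin 3) (Fin 3) ℝ := Matrix.of fun k a => e k a with hO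
  set H := hess u x with hH
  have hOO : O * O.transpose = 1 := by
    ext i j
    have := orthonormal_iff_ite.1 e.orthonormal i j
    rw [Matrix.mul_apply, Matrix.one_apply, ← this]
    simp [hO, PiLp.inner_apply, mul_comm]
  have hOO' : O.transpose * O = 1 := mul_eq_one_comm.1 hOO
  set V : Matrix (Fin 3) (Fin 3) ℝ := O * H * O.transpose with hV
  have hVe : ∀ k j, V k j = Dv (e k) (Dv (e j) u) x := by
    intro k j
    rw [Dv2_expand hu _ _ hx, hV]
    simp only [Matrix.mul_apply, Matrix.transpose_apply, hO, Matrix.of_apply, Finset.sum_mul]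
    rw [Finset.sum_comm]
  have hVs : ∀ k j, V k j = V j k := fun k j => by rw [hVe, hVe]; exact hu.comm _ _ x hx
  have htr : V.trace = H.trace := by
    rw [hV, Matrix.trace_mul_comm, ← Matrix.mul_assoc, hOO', Matrix.one_mul]
  have hdet : V.det = H.det := by
    have h1 : O.det * O.transpose.det = 1 := by rw [← Matrix.det_mul, hOO, Matrix.det_one]
    rw [hV, Matrix.det_mul, Matrix.det_mul]
    linear_combination H.det * h1
  have hVV : V * V = O * (H * H) * O.transpose := by
    rw [hV]
    calc O * H * O.transpose * (O * H * O.transpose)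
        = O * H * (O.transpose * O) * H * O.transpose := by simp only [Matrix.mul_assoc]
      _ = _ := by rw [hOO', Matrix.mul_one]; simp only [Matrix.mul_assoc]
  have htr2 : (V * V).trace = (H * H).trace := by
    rw [hVV, Matrix.trace_mul_comm, ← Matrix.mul_assoc, hOO', Matrix.one_mul]
  have s10 := hVs 1 0
  have s20 := hVs 2 0
  have s21 := hVs 2 1
  refine ⟨?_, ?_, ?_⟩
  · have : lap u x = H.trace := rfl
    rw [this, ← htr, Matrix.trace_fin_three, hVe, hVe, hVe]
  · unfold sigma2
    rw [← htr, ← htr2, ← hVe, ← hVe, ← hVe, ← hVe, ← hVe, ← hVe]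
    simp only [Matrix.trace_fin_three, Matrix.mul_apply, Fin.sum_univ_three, s10, s20, s21]
    ring
  · rw [← hdet, ← hVe, ← hVe, ← hVe, ← hVe, ← hVe, ← hVe, Matrix.det_fin_three, s10, s20, s21]
    ring

lemma frame_grad (u : E3 → ℝ) (e : OrthonormalBasis (Fin 3) ℝ E3) (x : E3) :
    grad u x = Dv (e 0) u x • e 0 + Dv (e 1) u x • e 1 + Dv (e 2) u x • e 2 ∧
    ‖grad u x‖ ^ 2 = Dv (e 0) u x ^ 2 + Dv (e 1) u x ^ 2 + Dv (e 2) u x ^ 2 := by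
  have hi : ∀ k, inner ℝ (e k) (grad u x) = Dv (e k) u x := by
    intro k
    rw [Dv_expand]
    simp [PiLp.inner_apply, grad, mul_comm]
  constructor
  · have := e.sum_repr' (grad u x)
    simp only [hi, Fin.sum_univ_three] at this
    exact this.symm
  · have := e.sum_sq_norm_inner_right (grad u x)
    simp only [hi, Fin.sum_univ_three, Real.norm_eq_abs, sq_abs] at this
    exact this.symm

lemma f_bounds {K : ℝ} {f : E3 × ℝ × E3 → ℝ}
    (hb : ∀ z, ∀ k : ℕ, k ≤ 2 → ‖iteratedFDeriv ℝ k f z‖ ≤ K) (z : E3 × ℝ × E3) :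
    |f z| ≤ K ∧ (∀ v, |fderiv ℝ f z v| ≤ K * ‖v‖) ∧
      ∀ v, |fderiv ℝ (fderiv ℝ f) z v v| ≤ K * ‖v‖ ^ 2 := by
  refine ⟨?_, ?_, ?_⟩
  · have := hb z 0 (by norm_num)
    rwa [norm_iteratedFDeriv_zero] at this
  · intro v
    have := hb z 1 (by norm_num)
    rw [norm_iteratedFDeriv_one] at this
    exact ((fderiv ℝ f z).le_opNorm v).trans (by gcongr)
  · intro v
    have := hb z 2 le_rfl
    have h2 := (iteratedFDeriv ℝ 2 f z).le_opNorm ![v, v]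
    rw [iteratedFDeriv_two_apply] at h2
    simp only [Fin.prod_univ_two, Matrix.cons_val_zero, Matrix.cons_val_one,
      Real.norm_eq_abs] at h2
    refine h2.trans ?_
    rw [sq]
    gcongr

/-- eigenframe -/
lemma eigenframe {u : E3 → ℝ} (hu : Sm u) {x : E3} (hx : x ∈ ball (0 : E3) 10) :
    ∃ (e : OrthonormalBasis (Fin 3) ℝ E3) (l : Fin 3 → ℝ),
      ∀ k j, Dv (e k) (Dv (e j) u) x = if k = j then l k else 0 := by
  have hH := hess_symm hu hx
  refine ⟨hH.eigenvectorBasis, hH.eigenvalues, ?_⟩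
  intro k j
  rw [Dv2_expand hu _ _ hx]
  have h1 := hH.mulVec_eigenvectorBasis j
  have h2 := orthonormal_iff_ite.1 hH.eigenvectorBasis.orthonormal k j
  have h3 : ∀ a, ∑ b, hess u x a b * hH.eigenvectorBasis j b
      = hH.eigenvalues j * hH.eigenvectorBasis j a := by
    intro a
    have := congrFun h1 a
    simpa [Matrix.mulVec, dotProduct] using this
  simp only [mul_assoc, ← Finset.mul_sum, h3]
  simp only [PiLp.inner_apply] at h2
  have h4 : ∑ a, hH.eigenvectorBasis k a * (hH.eigenvalues j * hH.eigenvectorBasis j a)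
      = hH.eigenvalues j * (if k = j then 1 else 0) := by
    rw [← h2, Finset.mul_sum]
    refine Finset.sum_congr rfl fun a _ => ?_
    simp
    ring
  rw [h4]
  split_ifs with h
  · rw [h, mul_one]
  · simp

lemma F_jet_s9 {f : E3 × ℝ × E3 → ℝ} {u : E3 → ℝ} (hf : ContDiff ℝ 2 f) (hu : Sm u)
    (e : OrthonormalBasis (Fin 3) ℝ E3) {x : E3} (hx : x ∈ ball (0 : E3) 10) (i : Fin 3)
    (z : E3 × ℝ × E3) (hz : z = (x, u x, grad u x)) (w : E3 × ℝ × E3)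
    (hw : w = (e i, Dv (e i) u x, Dv (e i) (Dv (e 0) u) x • e 0 + Dv (e i) (Dv (e 1) u) x • e 1
        + Dv (e i) (Dv (e 2) u) x • e 2)) :
    J2 (fun t => f (x + t • e i, u (x + t • e i), grad u (x + t • e i))) (f z)
      (fderiv ℝ f z w)
      (fderiv ℝ (fderiv ℝ f) z w w
        + (fderiv ℝ f z (0, 1, 0) * Dv (e i) (Dv (e i) u) x
          + (fderiv ℝ f z (0, 0, e 0) * Dv (e i) (Dv (e i) (Dv (e 0) u)) x
            + fderiv ℝ f z (0, 0, e 1) * Dv (e i) (Dv (e i) (Dv (e 1) u)) x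
            + fderiv ℝ f z (0, 0, e 2) * Dv (e i) (Dv (e i) (Dv (e 2) u)) x))) := by
  set γ : ℝ → E3 × ℝ × E3 := fun t => (x + t • e i, u (x + t • e i),
    Dv (e 0) u (x + t • e i) • e 0 + Dv (e 1) u (x + t • e i) • e 1
      + Dv (e 2) u (x + t • e i) • e 2) with hγ
  set γ' : ℝ → E3 × ℝ × E3 := fun t => (e i, Dv (e i) u (x + t • e i),
    Dv (e i) (Dv (e 0) u) (x + t • e i) • e 0 + Dv (e i) (Dv (e 1) u) (x + t • e i) • e 1
      + Dv (e i) (Dv (e 2) u) (x + t • e i) • e 2) with hγ'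
  have h1 : ∀ᶠ t in 𝓝 (0:ℝ), HasDerivAt γ (γ' t) t := by
    filter_upwards [line_near hx (e i)] with t ht
    refine HasDerivAt.prodMk ?_ (HasDerivAt.prodMk (hu.line_deriv x (e i) t ht) ?_)
    · simpa using ((hasDerivAt_id t).smul_const (e i)).const_add x
    · exact ((((hu.Dv _).line_deriv x (e i) t ht).smul_const _).add
        (((hu.Dv _).line_deriv x (e i) t ht).smul_const _)).add
        (((hu.Dv _).line_deriv x (e i) t ht).smul_const _)
  have hx0 : x + (0:ℝ) • e i ∈ ball (0 : E3) 10 := by simpa using hx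
  have h2 : HasDerivAt γ' (0, Dv (e i) (Dv (e i) u) (x + (0:ℝ) • e i),
    Dv (e i) (Dv (e i) (Dv (e 0) u)) (x + (0:ℝ) • e i) • e 0
      + Dv (e i) (Dv (e i) (Dv (e 1) u)) (x + (0:ℝ) • e i) • e 1
      + Dv (e i) (Dv (e i) (Dv (e 2) u)) (x + (0:ℝ) • e i) • e 2) 0 := by
    refine HasDerivAt.prodMk (hasDerivAt_const _ _)
      (HasDerivAt.prodMk ((hu.Dv _).line_deriv x (e i) 0 hx0) ?_)
    exact (((((hu.Dv _).Dv _).line_deriv x (e i) 0 hx0).smul_const _).add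
        ((((hu.Dv _).Dv _).line_deriv x (e i) 0 hx0).smul_const _)).add
        ((((hu.Dv _).Dv _).line_deriv x (e i) 0 hx0).smul_const _)
  have h0 : γ 0 = z := by
    rw [hz, (frame_grad u e x).1]; simp [hγ]
  have h0' : γ' 0 = w := by rw [hw]; simp [hγ']
  have := J2_comp hf h1 h2
  rw [h0, h0'] at this
  refine (this.congr ?_).cast rfl rfl ?_
  · refine Eventually.of_forall fun t => ?_
    simp only [hγ]
    rw [(frame_grad u e _).1]
  · congr 1
    have dec : ∀ (a b0 b1 b2 : ℝ), ((0 : E3), a, b0 • e 0 + b1 • e 1 + b2 • e 2)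
        = a • ((0 : E3), (1:ℝ), (0 : E3)) + (b0 • ((0 : E3), (0:ℝ), e 0)
          + b1 • ((0 : E3), (0:ℝ), e 1) + b2 • ((0 : E3), (0:ℝ), e 2)) := by
      intro a b0 b1 b2
      simp
    rw [dec]
    simp only [map_add, map_smul, smul_eq_mul, zero_smul, add_zero]
    ring

/-- The quantity `G`. -/
def Gq (f : E3 × ℝ × E3 → ℝ) (u : E3 → ℝ) (y : E3) : ℝ :=
  f (y, u y, grad u y) * lap u y - (hess u y).det

set_option maxHeartbeats 2000000 in
lemma key_max {K M : ℝ} {f : E3 × ℝ × E3 → ℝ} {u : E3 → ℝ} (hK : 1 ≤ K) (hM : 1 ≤ M)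
    (hyp : Hyp K f u) {x : E3} (hx : x ∈ ball (0 : E3) 5) (hlap : lap u x ≤ M)
    (hG0 : 0 < Gq f u x)
    (hmax : IsLocalMax (fun y => 2 * Real.log (25 - ‖y‖ ^ 2) + Real.log (Gq f u y)
      + 1 / 2 * ‖grad u y‖ ^ 2) x) :
    (25 - ‖x‖ ^ 2) ^ 2 * Gq f u x ≤ 24000 * K ^ 6 * M := by
  obtain ⟨hf, hfl, hfb, hu', heq, hpos, hbd⟩ := hyp
  have hu : Sm u := hu'
  have hx10 : x ∈ ball (0 : E3) 10 := ball_subset_ball (by norm_num) hx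
  have hxn : ‖x‖ < 5 := by simpa using hx
  obtain ⟨e, l, he⟩ := eigenframe hu hx10
  set T : Fin 3 → Fin 3 → Fin 3 → ℝ := fun k j i => Dv (e i) (Dv (e k) (Dv (e j) u)) x with hT
  set Q : Fin 3 → Fin 3 → ℝ := fun k i => Dv (e i) (Dv (e i) (Dv (e k) (Dv (e k) u))) x with hQ
  set z : E3 × ℝ × E3 := (x, u x, grad u x) with hz
  set p : Fin 3 → ℝ := fun k => Dv (e k) u x with hp
  set fx : Fin 3 → ℝ := fun k => fderiv ℝ f z (e k, 0, 0) with hfx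
  set fpp : Fin 3 → ℝ := fun k => fderiv ℝ f z (0, 0, e k) with hfp
  set fu : ℝ := fderiv ℝ f z (0, 1, 0) with hfu
  set w : Fin 3 → E3 × ℝ × E3 := fun i => (e i, p i, l i • e i) with hw
  set R : Fin 3 → ℝ := fun i => fderiv ℝ (fderiv ℝ f) z (w i) (w i) + fu * l i with hR
  set F1 : Fin 3 → ℝ := fun i => fx i + fu * p i + fpp i * l i with hF1
  set F2 : Fin 3 → ℝ := fun k => R k + (fpp 0 * T 0 k k + fpp 1 * T 1 k k + fpp 2 * T 2 k k)
    with hF2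
  set F : ℝ := f z with hF
  set s : ℝ := l 0 + l 1 + l 2 with hs
  have hT1 : ∀ i j k, T i j k = T j i k := fun i j k =>
    Dv_congr (hu.comm (e i) (e j)) (e k) x hx10
  have hT2 : ∀ i j k, T i j k = T i k j := by
    intro i j k
    simp only [hT]
    rw [(hu.Dv (e j)).comm (e k) (e i) x hx10, Dv_congr (hu.comm (e k) (e j)) (e i) x hx10,
      (hu.Dv (e k)).comm (e i) (e j) x hx10]
  have hQs : ∀ i j, Q i j = Q j i := by
    intro i k
    simp only [hQ]
    rw [Dv_congr ((hu.Dv (e i)).comm (e k) (e i)) (e k) x hx10,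
      ((hu.Dv (e i)).Dv (e k)).comm (e k) (e i) x hx10,
      Dv_congr (Dv_congr (hu.comm (e k) (e i)) (e k)) (e i) x hx10,
      Dv_congr ((hu.Dv (e k)).comm (e k) (e i)) (e i) x hx10]
  -- jets of the Hessian entries along `e i`
  have JU : ∀ i k j, J2 (fun t => Dv (e k) (Dv (e j) u) (x + t • e i)) (if k = j then l k else 0)
      (T k j i) (Dv (e i) (Dv (e i) (Dv (e k) (Dv (e j) u))) x) := by
    intro i k j
    rw [← he k j]
    exact ((hu.Dv _).Dv _).J2_line hx10 (e i)
  have JD : ∀ i k, J2 (fun t => Dv (e i) (Dv (e i) u) (x + t • e k)) (l i) (T i i k) (Q i k) := by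
    intro i k
    have := JU k i i
    rwa [if_pos rfl] at this
  have JO : ∀ i k j, k ≠ j → J2 (fun t => Dv (e k) (Dv (e j) u) (x + t • e i)) 0
      (T k j i) (Dv (e i) (Dv (e i) (Dv (e k) (Dv (e j) u))) x) := by
    intro i k j h
    have := JU i k j
    rwa [if_neg h] at this
  -- jet of F
  have JF : ∀ i, J2 (fun t => f (x + t • e i, u (x + t • e i), grad u (x + t • e i))) F
      (F1 i) (F2 i) := by
    intro i
    have hwi : w i = (e i, Dv (e i) u x, Dv (e i) (Dv (e 0) u) x • e 0
        + Dv (e i) (Dv (e 1) u) x • e 1 + Dv (e i) (Dv (e 2) u) x • e 2) := by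
      simp only [hw, he, hp]
      fin_cases i <;> simp
    have := F_jet_s9 hf hu e hx10 i z hz (w i) hwi
    refine this.cast rfl ?_ ?_
    · have : w i = (e i, (0:ℝ), (0:E3)) + p i • ((0:E3), (1:ℝ), (0:E3))
          + l i • ((0:E3), (0:ℝ), e i) := by
        simp [hw]
      simp only [hF1, hfx, hfu, hfp]
      rw [this]
      simp only [map_add, map_smul, smul_eq_mul]
      ring
    · have tt : ∀ k, Dv (e i) (Dv (e i) (Dv (e k) u)) x = T k i i := by
        intro k; rw [hT1]
      simp only [hF2, hR, tt, he]
      simp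
      ring
  -- equation
  have Jeq : ∀ i, J2 (fun t => f (x + t • e i, u (x + t • e i), grad u (x + t • e i)))
      (l 0 * l 1 + l 0 * l 2 + l 1 * l 2)
      ((s - l 0) * T 0 0 i + (s - l 1) * T 1 1 i + (s - l 2) * T 2 2 i)
      ((s - l 0) * Q 0 i + (s - l 1) * Q 1 i + (s - l 2) * Q 2 i
      + 2 * (T 0 0 i * T 1 1 i + T 0 0 i * T 2 2 i + T 1 1 i * T 2 2 i
        - T 0 1 i ^ 2 - T 0 2 i ^ 2 - T 1 2 i ^ 2)) := by
    intro i
    have o01 := JO i 0 1 (by decide)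
    have o02 := JO i 0 2 (by decide)
    have o12 := JO i 1 2 (by decide)
    have := ((((((JD 0 i).mul (JD 1 i)).add ((JD 0 i).mul (JD 2 i))).add
      ((JD 1 i).mul (JD 2 i))).sub (o01.mul o01)).sub (o02.mul o02)).sub (o12.mul o12)
    refine (this.congr ?_).cast (by ring) (by rw [hs]; ring) (by rw [hs]; ring)
    filter_upwards [line_near hx10 (e i)] with t ht
    rw [← heq _ ht, (frame_inv hu e ht).2.1]
  have hFe : F = l 0 * l 1 + l 0 * l 2 + l 1 * l 2 := ((JF 0).unique (Jeq 0)).1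
  have E1 : ∀ i, (s - l 0) * T 0 0 i + (s - l 1) * T 1 1 i + (s - l 2) * T 2 2 i = F1 i :=
    fun i => ((JF i).unique (Jeq i)).2.1.symm
  have E2 := fun i => ((JF i).unique (Jeq i)).2.2.symm
  -- jet of G
  set G : ℝ := Gq f u x with hG
  set G1 : Fin 3 → ℝ := fun i => F1 i * s + F * (T 0 0 i + T 1 1 i + T 2 2 i)
      - (l 1 * l 2 * T 0 0 i + l 0 * l 2 * T 1 1 i + l 0 * l 1 * T 2 2 i) with hG1
  set G2 : Fin 3 → ℝ := fun i => F2 i * s + 2 * F1 i * (T 0 0 i + T 1 1 i + T 2 2 i)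
      + F * (Q 0 i + Q 1 i + Q 2 i)
      - (l 1 * l 2 * Q 0 i + l 0 * l 2 * Q 1 i + l 0 * l 1 * Q 2 i
        + 2 * (l 2 * (T 0 0 i * T 1 1 i) + l 1 * (T 0 0 i * T 2 2 i) + l 0 * (T 1 1 i * T 2 2 i))
        - 2 * (l 2 * T 0 1 i ^ 2 + l 1 * T 0 2 i ^ 2 + l 0 * T 1 2 i ^ 2)) with hG2
  have hGe : G = F * s - l 0 * l 1 * l 2 := by
    have h := frame_inv hu e hx10
    simp only [hG, Gq]
    rw [h.1, h.2.2]
    simp only [he]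
    simp [hs, hF, hz]
  have hlape : lap u x = s := by
    rw [(frame_inv hu e hx10).1]
    simp only [he]
    simp [hs]
  have JG : ∀ i, J2 (fun t => Gq f u (x + t • e i)) G (G1 i) (G2 i) := by
    intro i
    have o01 := JO i 0 1 (by decide)
    have o02 := JO i 0 2 (by decide)
    have o12 := JO i 1 2 (by decide)
    have j1 := (JF i).mul (((JD 0 i).add (JD 1 i)).add (JD 2 i))
    have j2 := (((((JD 0 i).mul (JD 1 i)).mul (JD 2 i)).sub ((JD 0 i).mul (o12.mul o12))).sub
      ((JD 1 i).mul (o02.mul o02))).sub ((JD 2 i).mul (o01.mul o01))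
    have j3 := j2.add ((J2.const 2).mul ((o01.mul o02).mul o12))
    refine ((j1.sub j3).congr ?_).cast ?_ ?_ ?_
    · filter_upwards [line_near hx10 (e i)] with t ht
      have h := frame_inv hu e ht
      simp only [Gq]
      rw [h.1, h.2.2]
    · rw [hGe, hs]; ring
    · simp only [hG1]; rw [hs]; ring
    · simp only [hG2]; rw [hs]; ring
  -- jets of gradient and cutoff
  have Jp : ∀ i k, J2 (fun t => Dv (e k) u (x + t • e i)) (p k) (if i = k then l i else 0)
      (T k i i) := by
    intro i k
    have := (hu.Dv (e k)).J2_line hx10 (e i)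
    refine this.cast rfl (he i k) ?_
    rw [hT1]
  have Jg : ∀ i, J2 (fun t => 1 / 2 * ‖grad u (x + t • e i)‖ ^ 2)
      (1 / 2 * (p 0 * p 0 + p 1 * p 1 + p 2 * p 2)) (p i * l i)
      (l i ^ 2 + (p 0 * T 0 i i + p 1 * T 1 i i + p 2 * T 2 i i)) := by
    intro i
    have := (J2.const (1 / 2)).mul ((((Jp i 0).mul (Jp i 0)).add ((Jp i 1).mul (Jp i 1))).add
      ((Jp i 2).mul (Jp i 2)))
    refine (this.congr ?_).cast rfl ?_ ?_
    · refine Eventually.of_forall fun t => ?_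
      simp only []
      rw [(frame_grad u e _).2]; ring
    · fin_cases i <;> simp <;> ring
    · fin_cases i <;> simp <;> ring
  set xx : Fin 3 → ℝ := fun i => inner ℝ x (e i) with hxx
  set r : ℝ := 25 - ‖x‖ ^ 2 with hr
  have hr0 : 0 < r := by
    rw [hr]; nlinarith [norm_nonneg x]
  have Jr : ∀ i, J2 (fun t : ℝ => 25 - ‖x + t • e i‖ ^ 2) r (-2 * xx i) (-2) := by
    intro i
    have hid : J2 (fun t : ℝ => t) 0 1 0 :=
      ⟨rfl, fun _ => 1, Eventually.of_forall fun t => hasDerivAt_id t, rfl, hasDerivAt_const _ _⟩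
    have := ((J2.const r).sub ((J2.const (2 * xx i)).mul hid)).sub (hid.mul hid)
    refine (this.congr ?_).cast (by ring) (by ring) (by ring)
    refine Eventually.of_forall fun t => ?_
    simp only []
    rw [norm_add_sq_real, norm_smul, inner_smul_right, e.norm_eq_one, hr, hxx]
    simp only [Real.norm_eq_abs, mul_one, sq_abs]
    ring
  have JP : ∀ i, 2 * (-2 * xx i / r) + G1 i / G + p i * l i = 0 ∧
      2 * (-2 / r - (-2 * xx i / r) ^ 2) + (G2 i / G - (G1 i / G) ^ 2)
      + (l i ^ 2 + (p 0 * T 0 i i + p 1 * T 1 i i + p 2 * T 2 i i)) ≤ 0 := by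
    intro i
    have j := (((J2.const 2).mul ((Jr i).log hr0)).add ((JG i).log hG0)).add (Jg i)
    have hm : IsLocalMax (fun t : ℝ => 2 * Real.log (25 - ‖x + t • e i‖ ^ 2)
        + Real.log (Gq f u (x + t • e i)) + 1 / 2 * ‖grad u (x + t • e i)‖ ^ 2) 0 := by
      have hcont : Continuous fun t : ℝ => x + t • e i := by fun_prop
      have h0 : Tendsto (fun t : ℝ => x + t • e i) (𝓝 0) (𝓝 x) := by
        have := hcont.tendsto 0
        simpa using this
      have := h0.eventually hmax
      simpa [IsLocalMax, IsMaxFilter] using this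
    have := j.max hm
    refine ⟨?_, ?_⟩
    · linarith [this.1]
    · linarith [this.2]
  have en : ∀ i, ‖e i‖ = 1 := fun i => e.norm_eq_one i
  have hgK : ‖grad u x‖ ≤ K := by
    have := hbd x hx10
    linarith [abs_nonneg (u x)]
  have hpK : ∀ i, |p i| ≤ K := by
    intro i
    have h1 := (frame_grad u e x).2
    have h2 : p i ^ 2 ≤ ‖grad u x‖ ^ 2 := by
      rw [h1]
      fin_cases i <;> simp only [hp] <;> simp <;> nlinarith [sq_nonneg (Dv (e 0) u x),
        sq_nonneg (Dv (e 1) u x), sq_nonneg (Dv (e 2) u x)]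
    exact (abs_le_of_sq_le_sq h2 (norm_nonneg _)).trans hgK
  have fb := f_bounds hfb z
  refine final_alg K M r G l F1 F2 R fpp fx xx p G1 G2 fu T Q F s hK hM (hlape ▸ hlap) hr0
    (by rw [hr]; nlinarith [sq_nonneg ‖x‖]) hT1 hT2 hQs hs (hlape ▸ hpos x hx10) hFe (hfl z)
    ((le_abs_self _).trans fb.1) hGe E1 E2 (fun _ => rfl) (fun _ => rfl) (fun _ => rfl)
    (fun _ => rfl) ?_ ?_ ?_ hpK ?_ ?_ (fun i => (JP i).1) (fun i => (JP i).2)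
  · intro i
    have := fb.2.1 (e i, 0, 0)
    simpa [Prod.norm_def, en] using this
  · have := fb.2.1 (0, 1, 0)
    simpa [Prod.norm_def] using this
  · intro i
    have := fb.2.1 (0, 0, e i)
    simpa [Prod.norm_def, en] using this
  · intro i
    have := abs_real_inner_le_norm x (e i)
    rw [en, mul_one] at this
    exact this.trans hxn.le
  · intro i
    have h1 := fb.2.2 (w i)
    have h2 : ‖w i‖ ≤ 1 + K + |l i| := by
      have := hpK i
      have := abs_nonneg (l i)
      simp only [hw, Prod.norm_def, norm_smul, en, Real.norm_eq_abs, mul_one]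
      refine max_le (by linarith) (max_le (by linarith) (by linarith))
    have h3 : |fu| ≤ K := by
      have := fb.2.1 (0, 1, 0)
      simpa [Prod.norm_def] using this
    calc |R i| ≤ |fderiv ℝ (fderiv ℝ f) z (w i) (w i)| + |fu * l i| := abs_add_le _ _
      _ ≤ K * ‖w i‖ ^ 2 + K * |l i| := by rw [abs_mul]; gcongr
      _ ≤ _ := by gcongr

lemma Sm.cont {φ : E3 → ℝ} (h : Sm φ) : ContinuousOn φ (ball (0 : E3) 10) :=
  ContDiffOn.continuousOn h

lemma cont_grad {u : E3 → ℝ} (hu : Sm u) : ContinuousOn (grad u) (ball (0 : E3) 10) := by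
  have e := EuclideanSpace.basisFun (Fin 3) ℝ
  have h : grad u = fun x => Dv (e 0) u x • e 0 + Dv (e 1) u x • e 1 + Dv (e 2) u x • e 2 :=
    funext fun x => (frame_grad u e x).1
  rw [h]
  have c : ∀ i, ContinuousOn (Dv (e i) u) (ball (0 : E3) 10) := fun i => (hu.Dv _).cont
  exact (((c 0).smul continuousOn_const).add ((c 1).smul continuousOn_const)).add
    ((c 2).smul continuousOn_const)

lemma cont_hess {u : E3 → ℝ} (hu : Sm u) (i j : Fin 3) :
    ContinuousOn (fun x => hess u x i j) (ball (0 : E3) 10) :=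
  ((hu.Dv (EuclideanSpace.single j 1)).Dv (EuclideanSpace.single i 1)).cont

lemma cont_lap {u : E3 → ℝ} (hu : Sm u) : ContinuousOn (lap u) (ball (0 : E3) 10) :=
  continuousOn_finsetSum _ fun i _ => cont_hess hu i i

lemma cont_G {f : E3 × ℝ × E3 → ℝ} {u : E3 → ℝ} (hf : Continuous f) (hu : Sm u) :
    ContinuousOn (Gq f u) (ball (0 : E3) 10) := by
  have h1 : ContinuousOn (fun y => f (y, u y, grad u y)) (ball (0 : E3) 10) :=
    hf.comp_continuousOn (continuousOn_id.prodMk (hu.cont.prodMk (cont_grad hu)))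
  have h2 : ContinuousOn (fun y => (hess u y).det) (ball (0 : E3) 10) := by
    simp only [Matrix.det_fin_three]
    have c := cont_hess hu
    exact ((((((((c 0 0).mul (c 1 1)).mul (c 2 2)).sub (((c 0 0).mul (c 1 2)).mul (c 2 1))).sub
      (((c 0 1).mul (c 1 0)).mul (c 2 2))).add (((c 0 1).mul (c 1 2)).mul (c 2 0))).add
      (((c 0 2).mul (c 1 0)).mul (c 2 1))).sub (((c 0 2).mul (c 1 1)).mul (c 2 0)))
  exact (h1.mul (cont_lap hu)).sub h2

lemma lap_le_sup {u : E3 → ℝ} (hu : Sm u) {y : E3} (hy : y ∈ ball (0 : E3) 5) :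
    lap u y ≤ sSup (lap u '' ball (0 : E3) 5) := by
  have hb : BddAbove (lap u '' closedBall (0 : E3) 5) :=
    (isCompact_closedBall (0 : E3) 5).bddAbove_image
      ((cont_lap hu).mono (closedBall_subset_ball (by norm_num)))
  exact le_csSup (hb.mono (Set.image_mono ball_subset_closedBall)) (Set.mem_image_of_mem _ hy)

lemma G_le {K : ℝ} {f : E3 × ℝ × E3 → ℝ} {u : E3 → ℝ} (hK : 1 ≤ K) (hyp : Hyp K f u)
    {M : ℝ} (hM : 1 ≤ M) (hlap : ∀ y ∈ ball (0 : E3) 5, lap u y ≤ M)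
    {x : E3} (hx : x ∈ ball (0 : E3) 4) (hG : 0 < Gq f u x) :
    Gq f u x ≤ 24000 * K ^ 6 * Real.exp (1 / 2 * K ^ 2) * M := by
  have hu : Sm u := hyp.2.2.2.1
  have hbd := hyp.2.2.2.2.2.2
  set Φ : E3 → ℝ := fun y => (25 - ‖y‖ ^ 2) ^ 2 * Gq f u y * Real.exp (1 / 2 * ‖grad u y‖ ^ 2)
    with hΦ
  have cG := cont_G hyp.1.continuous hu
  have cΦ : ContinuousOn Φ (ball (0 : E3) 10) := by
    have c1 : ContinuousOn (fun y : E3 => (25 - ‖y‖ ^ 2) ^ 2) (ball (0 : E3) 10) := by fun_prop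
    have c2 : ContinuousOn (fun y : E3 => Real.exp (1 / 2 * ‖grad u y‖ ^ 2)) (ball (0 : E3) 10) :=
      Real.continuous_exp.comp_continuousOn
        (continuousOn_const.mul ((cont_grad hu).norm.pow 2))
    exact (c1.mul cG).mul c2
  have hxn : ‖x‖ < 4 := by simpa using hx
  have hx2 : ‖x‖ ^ 2 < 16 := by nlinarith [norm_nonneg x]
  have h9 : 81 ≤ (25 - ‖x‖ ^ 2) ^ 2 := by nlinarith
  have hΦx : Gq f u x ≤ Φ x := by
    have he : 1 ≤ Real.exp (1 / 2 * ‖grad u x‖ ^ 2) := Real.one_le_exp (by positivity)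
    have h1 : Gq f u x ≤ (25 - ‖x‖ ^ 2) ^ 2 * Gq f u x := by nlinarith
    calc Gq f u x ≤ (25 - ‖x‖ ^ 2) ^ 2 * Gq f u x := h1
      _ ≤ _ := le_mul_of_one_le_right (hG.le.trans h1) he
  obtain ⟨x₀, hx₀, hmx⟩ := (isCompact_closedBall (0 : E3) 5).exists_isMaxOn
    ⟨0, by simp⟩ (cΦ.mono (closedBall_subset_ball (by norm_num)))
  have hle : Φ x ≤ Φ x₀ := hmx (by simp; linarith)
  have hp0 : 0 < Φ x₀ := by linarith
  have hn5 : ‖x₀‖ ≤ 5 := by simpa using hx₀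
  have hne : ‖x₀‖ ≠ 5 := by
    intro h
    simp only [hΦ, h] at hp0
    norm_num at hp0
  have hlt : ‖x₀‖ < 5 := lt_of_le_of_ne hn5 hne
  have hb5 : x₀ ∈ ball (0 : E3) 5 := by simpa using hlt
  have hb10 : x₀ ∈ ball (0 : E3) 10 := ball_subset_ball (by norm_num) hb5
  have hG0 : 0 < Gq f u x₀ := by
    have h1 := (pos_iff_pos_of_mul_pos hp0).2 (Real.exp_pos _)
    exact pos_of_mul_pos_right h1 (sq_nonneg _)
  have hlogΦ : ∀ y : E3, ‖y‖ < 5 → 0 < Gq f u y → Real.log (Φ y) =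
      2 * Real.log (25 - ‖y‖ ^ 2) + Real.log (Gq f u y) + 1 / 2 * ‖grad u y‖ ^ 2 := by
    intro y hy hGy
    have : 0 < 25 - ‖y‖ ^ 2 := by nlinarith [norm_nonneg y]
    simp only [hΦ]
    rw [Real.log_mul (by positivity) (by positivity), Real.log_mul (by positivity) (by positivity),
      Real.log_exp, Real.log_pow]
    norm_num
  have hmax : IsLocalMax (fun y => 2 * Real.log (25 - ‖y‖ ^ 2) + Real.log (Gq f u y)
      + 1 / 2 * ‖grad u y‖ ^ 2) x₀ := by
    have hc : ContinuousAt (Gq f u) x₀ := cG.continuousAt (isOpen_ball.mem_nhds hb10)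
    filter_upwards [hc.eventually (lt_mem_nhds hG0), isOpen_ball.mem_nhds hb5] with y hy1 hy2
    have hy3 : ‖y‖ < 5 := by simpa using hy2
    rw [← hlogΦ y hy3 hy1, ← hlogΦ x₀ hlt hG0]
    have : 0 < 25 - ‖y‖ ^ 2 := by nlinarith [norm_nonneg y]
    refine Real.log_le_log ?_ (hmx (ball_subset_closedBall hy2))
    simp only [hΦ]
    positivity
  have hk := key_max hK hM hyp hb5 (hlap x₀ hb5) hG0 hmax
  have hgK : ‖grad u x₀‖ ≤ K := by
    have := hbd x₀ hb10
    linarith [abs_nonneg (u x₀)]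
  calc Gq f u x ≤ Φ x₀ := hΦx.trans hle
    _ = (25 - ‖x₀‖ ^ 2) ^ 2 * Gq f u x₀ * Real.exp (1 / 2 * ‖grad u x₀‖ ^ 2) := rfl
    _ ≤ 24000 * K ^ 6 * M * Real.exp (1 / 2 * K ^ 2) := by
        have : ‖grad u x₀‖ ^ 2 ≤ K ^ 2 := by gcongr
        have : Real.exp (1 / 2 * ‖grad u x₀‖ ^ 2) ≤ Real.exp (1 / 2 * K ^ 2) :=
          Real.exp_le_exp.2 (by linarith)
        gcongr
    _ = _ := by ring

lemma final_step {C C2 M G : ℝ} (hC2 : 0 < C2) (hC : C = 2 * C2 + Real.exp 1) (hM : C ≤ M)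
    (hG : C ≤ G) (h : G ≤ C2 * M) : G ≤ C * (M / Real.sqrt (Real.log M)) * Real.log G := by
  have he : 1 < Real.exp 1 := Real.one_lt_exp_iff.2 one_pos
  have hM0 : 0 < M := by linarith
  have hG0 : 0 < G := by linarith
  have hlM : 1 ≤ Real.log M := (Real.le_log_iff_exp_le hM0).2 (by linarith)
  have hlG : 1 ≤ Real.log G := (Real.le_log_iff_exp_le hG0).2 (by linarith)
  set s := Real.sqrt (Real.log M) with hs
  have hs1 : 1 ≤ s := Real.one_le_sqrt.2 hlM
  have hss : s * s = Real.log M := Real.mul_self_sqrt (by linarith)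
  have hC1 : 1 ≤ C := by linarith
  have hq : 0 < M / s := by positivity
  by_cases hc : G ≤ M / s
  · calc G ≤ M / s := hc
      _ ≤ C * (M / s) := le_mul_of_one_le_left hq.le hC1
      _ ≤ _ := le_mul_of_one_le_right (by positivity) hlG
  · push Not at hc
    have h1 : Real.log (M / s) ≤ Real.log G := Real.log_le_log hq hc.le
    rw [Real.log_div hM0.ne' (by linarith)] at h1
    have h2 : Real.log s = Real.log (Real.log M) / 2 := by
      rw [hs, Real.log_sqrt (by linarith)]
    have h3 : Real.log (Real.log M) ≤ Real.log M :=
      (Real.log_le_sub_one_of_pos (by linarith)).trans (by linarith)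
    have h4 : s * s / 2 ≤ Real.log G := by rw [hss]; linarith
    calc G ≤ C2 * M := h
      _ ≤ C * M / 2 := by nlinarith
      _ ≤ C * M / 2 * s := le_mul_of_one_le_right (by positivity) hs1
      _ = C * (M / s) * (s * s / 2) := by field_simp
      _ ≤ _ := by gcongr


/-- Lemma 5, second part: with `G = F·Δu − det D²u` and `M₅ = sup_{B₅} Δu`, if `M₅ ≥ C`
then `G ≤ C · (M₅ / (log M₅)^{1/2}) · log G` at every point of `B₄` where `G ≥ C`. -/
theorem stmt_9 :
    ∀ K : ℝ, 1 ≤ K → ∃ C : ℝ, 0 < C ∧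
      ∀ (f : E3 × ℝ × E3 → ℝ) (u : E3 → ℝ), Hyp K f u →
        C ≤ sSup (lap u '' ball (0 : E3) 5) →
        ∀ x ∈ ball (0 : E3) 4,
          C ≤ f (x, u x, grad u x) * lap u x - (hess u x).det →
          f (x, u x, grad u x) * lap u x - (hess u x).det ≤
            C * (sSup (lap u '' ball (0 : E3) 5) /
                  Real.sqrt (Real.log (sSup (lap u '' ball (0 : E3) 5)))) *
              Real.log (f (x, u x, grad u x) * lap u x - (hess u x).det) := by
  intro K hK
  have hC2 : 0 < 24000 * K ^ 6 * Real.exp (1 / 2 * K ^ 2) := by positivity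
  refine ⟨2 * (24000 * K ^ 6 * Real.exp (1 / 2 * K ^ 2)) + Real.exp 1, by positivity, ?_⟩
  intro f u hyp hM x hx hG
  have he : 1 < Real.exp 1 := Real.one_lt_exp_iff.2 one_pos
  refine final_step hC2 rfl hM hG ?_
  exact G_le hK hyp (by linarith) (fun y hy => lap_le_sup hyp.2.2.2.1 hy) hx
    (lt_of_lt_of_le (by positivity) hG)
end
end
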